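/- arXiv:2401.00485 — 3 statements merged into one kernel-verified Lean document; each statement's English description precedes it below -/
import Mathlib

section
/- Let A and B be complex unital Banach algebras with B semisimple, and let T : A → B be a surjective additive map that preserves the spectral radius, i.e. r(Tx) = r(x) for all x ∈ A. Then T is continuous. -/
open Filter Topology MeasureTheory
open scoped NNReal ENNReal

namespace SpectralRadiusPreserver

section SpectralRadius

variable {A : Type*} [NormedRing A] [NormedAlgebra ℂ A] [CompleteSpace A]

theorem eventually_norm_pow_le_of_spectralRadius_lt {x : A} {m : ℝ≥0}
    (h : spectralRadius ℂ x < m) : ∀ᶠ n : ℕ in atTop, ‖x ^ n‖ ≤ (m : ℝ) ^ n := by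
  have h1 := (spectrum.pow_nnnorm_pow_one_div_tendsto_nhds_spectralRadius x).eventually_lt_const h
  filter_upwards [h1, eventually_gt_atTop 0] with n hn hn0
  have hn' : (0 : ℝ) < n := by exact_mod_cast hn0
  rw [one_div, ENNReal.rpow_inv_lt_iff hn', ENNReal.rpow_natCast] at hn
  exact_mod_cast hn.le

theorem spectralRadius_le_of_norm_pow_le {x : A} {m : ℝ≥0} {n : ℕ} (hn : 0 < n)
    (h : ‖x ^ n‖ ≤ (m : ℝ) ^ n) : spectralRadius ℂ x ≤ m := by
  have h1 := (spectrum.pow_nnnorm_pow_one_div_tendsto_nhds_spectralRadius x).comp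
    (tendsto_id.const_mul_atTop' hn)
  refine le_of_tendsto h1 ?_
  filter_upwards [eventually_gt_atTop 0] with k hk
  have hnk : (0 : ℝ) < ((n * k : ℕ) : ℝ) := by exact_mod_cast Nat.mul_pos hn hk
  simp only [Function.comp_apply, id]
  rw [one_div, ENNReal.rpow_inv_le_iff hnk, ENNReal.rpow_natCast]
  have h2 : ‖x ^ (n * k)‖ ≤ (m : ℝ) ^ (n * k) := by
    rw [pow_mul, pow_mul]
    exact (norm_pow_le' _ hk).trans (pow_le_pow_left₀ (norm_nonneg _) h k)
  exact_mod_cast h2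

/-- Upper semicontinuity of the spectral radius. -/
theorem eventually_spectralRadius_lt {x : A} {m : ℝ≥0} (h : spectralRadius ℂ x < m) :
    ∀ᶠ w in 𝓝 x, spectralRadius ℂ w < m := by
  obtain ⟨m₁, hm₁, hm₁m⟩ := ENNReal.lt_iff_exists_nnreal_btwn.1 h
  obtain ⟨m₂, hm₂, hm₂m⟩ := ENNReal.lt_iff_exists_nnreal_btwn.1 hm₁m
  obtain ⟨n, hn, hn0⟩ := ((eventually_norm_pow_le_of_spectralRadius_lt hm₁).and
    (eventually_gt_atTop 0)).exists
  have hlt : ‖x ^ n‖ < (m₂ : ℝ) ^ n :=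
    hn.trans_lt (pow_lt_pow_left₀ (by exact_mod_cast hm₂) m₁.2 hn0.ne')
  have hc : ContinuousAt (fun w : A => ‖w ^ n‖) x := by fun_prop
  filter_upwards [hc.eventually_lt_const hlt] with w hw
  exact (spectralRadius_le_of_norm_pow_le hn0 hw.le).trans_lt hm₂m

end SpectralRadius

section Extrapolation

variable {A : Type*} [NormedRing A] [NormedAlgebra ℝ A]

theorem exists_coeff_add_smul_pow (y a : A) {R : ℝ} (hR : 0 ≤ R) (n : ℕ) :
    ∃ c : ℕ → A, (∀ x : ℝ, (y + x • a) ^ n = ∑ j ∈ Finset.range (n + 1), x ^ j • c j) ∧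
      ∑ j ∈ Finset.range (n + 1), R ^ j * ‖c j‖ ≤ ‖(1 : A)‖ * (‖y‖ + R * ‖a‖) ^ n := by
  induction n with
  | zero => exact ⟨fun _ => 1, by simp, by simp⟩
  | succ n ih =>
    obtain ⟨c, hc, hcb⟩ := ih
    let c₁ : ℕ → A := fun j => if j ≤ n then c j * y else 0
    let c₂ : ℕ → A := fun j => if j = 0 then 0 else c (j - 1) * a
    refine ⟨fun j => c₁ j + c₂ j, fun x => ?_, ?_⟩
    · have e1 : ∑ j ∈ Finset.range (n + 2), x ^ j • c₁ j
          = ∑ j ∈ Finset.range (n + 1), x ^ j • (c j * y) := by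
        rw [Finset.sum_range_succ]
        simp only [c₁, Nat.not_succ_le_self, if_false, smul_zero, add_zero]
        refine Finset.sum_congr rfl fun j hj => ?_
        rw [if_pos (Nat.lt_succ_iff.1 (Finset.mem_range.1 hj))]
      have e2 : ∑ j ∈ Finset.range (n + 2), x ^ j • c₂ j
          = ∑ j ∈ Finset.range (n + 1), x ^ (j + 1) • (c j * a) := by
        rw [Finset.sum_range_succ']
        simp [c₂]
      simp only [smul_add, Finset.sum_add_distrib]
      rw [e1, e2, pow_succ, hc, mul_add, Finset.sum_mul, Finset.sum_mul]
      simp only [smul_mul_assoc, mul_smul_comm, smul_smul, pow_succ']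
    · have e1 : ∑ j ∈ Finset.range (n + 2), R ^ j * ‖c₁ j‖
          ≤ ∑ j ∈ Finset.range (n + 1), R ^ j * ‖c j‖ * ‖y‖ := by
        rw [Finset.sum_range_succ]
        simp only [c₁, Nat.not_succ_le_self, if_false, norm_zero, mul_zero, add_zero]
        refine Finset.sum_le_sum fun j hj => ?_
        rw [if_pos (Nat.lt_succ_iff.1 (Finset.mem_range.1 hj)), mul_assoc]
        gcongr
        exact norm_mul_le _ _
      have e2 : ∑ j ∈ Finset.range (n + 2), R ^ j * ‖c₂ j‖
          ≤ ∑ j ∈ Finset.range (n + 1), R ^ j * ‖c j‖ * (R * ‖a‖) := by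
        rw [Finset.sum_range_succ']
        simp only [c₂, Nat.succ_ne_zero, if_false, if_true, norm_zero, mul_zero, add_zero,
          Nat.add_sub_cancel]
        refine Finset.sum_le_sum fun j _ => ?_
        calc R ^ (j + 1) * ‖c j * a‖ ≤ R ^ (j + 1) * (‖c j‖ * ‖a‖) := by
              gcongr
              exact norm_mul_le _ _
          _ = R ^ j * ‖c j‖ * (R * ‖a‖) := by ring
      calc ∑ j ∈ Finset.range (n + 2), R ^ j * ‖c₁ j + c₂ j‖
          ≤ ∑ j ∈ Finset.range (n + 2), (R ^ j * ‖c₁ j‖ + R ^ j * ‖c₂ j‖) := by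
            refine Finset.sum_le_sum fun j _ => ?_
            rw [← mul_add]
            gcongr
            exact norm_add_le _ _
        _ ≤ (∑ j ∈ Finset.range (n + 1), R ^ j * ‖c j‖) * (‖y‖ + R * ‖a‖) := by
            rw [Finset.sum_add_distrib, mul_add, Finset.sum_mul, Finset.sum_mul]
            exact add_le_add e1 e2
        _ ≤ ‖(1 : A)‖ * (‖y‖ + R * ‖a‖) ^ n * (‖y‖ + R * ‖a‖) := by gcongr
        _ = _ := by ring

theorem prod_erase_abs_sub (N i : ℕ) (hi : i ≤ N) :
    ∏ j ∈ (Finset.range (N + 1)).erase i, |(i : ℝ) - j| =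
      (i.factorial : ℝ) * (N - i).factorial := by
  obtain ⟨k, rfl⟩ := Nat.exists_eq_add_of_le hi
  have h1 : ∏ j ∈ (Finset.range (i + k + 1)).erase i, |(i : ℝ) - j| =
      ∏ j ∈ (Finset.range (i + k + 1)).erase i, (if j = i then 1 else |(i : ℝ) - j|) :=
    Finset.prod_congr rfl fun j hj => (if_neg (Finset.ne_of_mem_erase hj)).symm
  rw [h1, Finset.prod_erase (f := fun j => if j = i then (1 : ℝ) else |(i : ℝ) - j|) _
    (if_pos rfl), show i + k + 1 = i + (k + 1) by ring,
    Finset.prod_range_add, Finset.prod_range_succ', Nat.add_sub_cancel_left]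
  have h2 : ∏ j ∈ Finset.range i, (if j = i then (1 : ℝ) else |(i : ℝ) - j|) = i.factorial := by
    rw [← Finset.prod_range_reflect, ← Finset.prod_range_add_one_eq_factorial, Nat.cast_prod]
    refine Finset.prod_congr rfl fun j hj => ?_
    have hj' := Finset.mem_range.1 hj
    rw [if_neg (by omega), Nat.sub_sub, Nat.cast_sub (by omega), abs_of_nonneg] <;>
      push_cast <;> linarith
  have h3 : ∏ j ∈ Finset.range k, (if i + (j + 1) = i then (1 : ℝ) else
      |(i : ℝ) - ((i + (j + 1) : ℕ) : ℝ)|) = k.factorial := by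
    rw [← Finset.prod_range_add_one_eq_factorial, Nat.cast_prod]
    refine Finset.prod_congr rfl fun j _ => ?_
    rw [if_neg (by omega), abs_sub_comm, abs_of_nonneg] <;> push_cast <;> linarith
  rw [h2, h3]
  simp

/-- Lagrange weights at `0` for `N + 1` separated nodes in `[-2, 2]`. -/
theorem exists_lagrange_weights (N : ℕ) (x : ℕ → ℝ) {δ : ℝ} (hδ : 0 < δ)
    (hx : ∀ i ≤ N, |x i| ≤ 2)
    (hsep : ∀ i ≤ N, ∀ j ≤ N, δ * |(i : ℝ) - j| ≤ |x i - x j|) :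
    ∃ l : ℕ → ℝ, (∀ j ≤ N, ∑ i ∈ Finset.range (N + 1), l i * x i ^ j = (0 : ℝ) ^ j) ∧
      ∑ i ∈ Finset.range (N + 1), |l i| ≤ (4 / δ) ^ N / N.factorial := by
  have hinj : Set.InjOn x (Finset.range (N + 1) : Finset ℕ) := by
    intro i hi j hj hij
    have hi' : i ≤ N := by simpa [Nat.lt_succ_iff] using hi
    have hj' : j ≤ N := by simpa [Nat.lt_succ_iff] using hj
    have h := hsep i hi' j hj'
    rw [hij, sub_self, abs_zero] at h
    have h2 : |(i : ℝ) - j| ≤ 0 := by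
      by_contra! h3
      exact absurd h (not_le.2 (mul_pos hδ h3))
    have h4 := abs_nonpos_iff.1 h2
    exact_mod_cast sub_eq_zero.1 h4
  refine ⟨fun i => (Lagrange.basis (Finset.range (N + 1)) x i).eval 0, fun j hj => ?_, ?_⟩
  · have h := Lagrange.eq_interpolate (f := (Polynomial.X : Polynomial ℝ) ^ j) hinj (by
      rw [Polynomial.degree_X_pow, Finset.card_range]
      exact_mod_cast Nat.lt_succ_of_le hj)
    have h2 := congrArg (Polynomial.eval 0) h
    rw [Lagrange.interpolate_apply, Polynomial.eval_finsetSum] at h2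
    simp only [Polynomial.eval_mul, Polynomial.eval_C, Polynomial.eval_pow,
      Polynomial.eval_X] at h2
    rw [h2]
    exact Finset.sum_congr rfl fun i _ => mul_comm _ _
  · have hb : ∀ i ∈ Finset.range (N + 1),
        |(Lagrange.basis (Finset.range (N + 1)) x i).eval 0|
          ≤ (2 / δ) ^ N / N.factorial * (N.choose i) := by
      intro i hi
      have hiN : i ≤ N := Nat.lt_succ_iff.1 (Finset.mem_range.1 hi)
      rw [Lagrange.basis, Polynomial.eval_prod, Finset.abs_prod]
      have hcard : ((Finset.range (N + 1)).erase i).card = N := by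
        rw [Finset.card_erase_of_mem hi, Finset.card_range, Nat.add_sub_cancel]
      calc ∏ j ∈ (Finset.range (N + 1)).erase i,
            |(Lagrange.basisDivisor (x i) (x j)).eval 0|
          ≤ ∏ j ∈ (Finset.range (N + 1)).erase i, (2 / δ) / |(i : ℝ) - j| := by
            refine Finset.prod_le_prod (fun _ _ => abs_nonneg _) fun j hj => ?_
            rw [Finset.mem_erase, Finset.mem_range] at hj
            have hjN : j ≤ N := Nat.lt_succ_iff.1 hj.2
            have hij : 0 < |(i : ℝ) - j| := by
              rw [abs_pos, sub_ne_zero]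
              exact_mod_cast hj.1.symm
            simp only [Lagrange.basisDivisor, Polynomial.eval_mul, Polynomial.eval_C,
              Polynomial.eval_sub, Polynomial.eval_X, zero_sub, abs_mul, abs_inv, abs_neg]
            rw [div_div, inv_mul_eq_div]
            exact div_le_div₀ zero_le_two (hx j hjN) (mul_pos hδ hij) (hsep i hiN j hjN)
        _ = (2 / δ) ^ N / N.factorial * (N.choose i) := by
            rw [Finset.prod_div_distrib, Finset.prod_const, hcard, prod_erase_abs_sub N i hiN,
              Nat.cast_choose ℝ hiN]
            have := Nat.factorial_ne_zero N
            field_simp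
    calc _ ≤ ∑ i ∈ Finset.range (N + 1), (2 / δ) ^ N / N.factorial * (N.choose i : ℝ) :=
          Finset.sum_le_sum hb
      _ = (4 / δ) ^ N / N.factorial := by
          rw [← Finset.mul_sum]
          have : ∑ i ∈ Finset.range (N + 1), (N.choose i : ℝ) = 2 ^ N := by
            exact_mod_cast Nat.sum_range_choose N
          rw [this, div_mul_eq_mul_div, ← mul_pow]
          congr 2
          ring

theorem norm_pow_le_of_norm_pow_nodes_le (y a : A)
    {R : ℝ} (hR : 2 ≤ R) {N n : ℕ} (hNn : N ≤ n) {x l : ℕ → ℝ} {W D : ℝ} (hD : 0 ≤ D)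
    (hx : ∀ i ≤ N, |x i| ≤ 2)
    (hl : ∀ j ≤ N, ∑ i ∈ Finset.range (N + 1), l i * x i ^ j = (0 : ℝ) ^ j)
    (hW : ∑ i ∈ Finset.range (N + 1), |l i| ≤ W)
    (hnode : ∀ i ≤ N, ‖(y + x i • a) ^ n‖ ≤ D) :
    ‖y ^ n‖ ≤ W * (D + (2 / R) ^ N * (‖(1 : A)‖ * (‖y‖ + R * ‖a‖) ^ n)) := by
  obtain ⟨c, hc, hcb⟩ := exists_coeff_add_smul_pow y a (zero_le_two.trans hR) n
  have hR0 : 0 < R := by linarith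
  set P : ℝ → A := fun t => ∑ j ∈ Finset.range (N + 1), t ^ j • c j with hP
  set Q : ℝ → A := fun t => ∑ j ∈ Finset.Ico (N + 1) (n + 1), t ^ j • c j with hQ
  have hPQ : ∀ t, (y + t • a) ^ n = P t + Q t := fun t => by
    rw [hc, hP, hQ]
    exact (Finset.sum_range_add_sum_Ico _ (Nat.succ_le_succ hNn)).symm
  have hQb : ∀ i ≤ N, ‖Q (x i)‖ ≤ (2 / R) ^ N * (‖(1 : A)‖ * (‖y‖ + R * ‖a‖) ^ n) := by
    intro i hi
    calc ‖Q (x i)‖ ≤ ∑ j ∈ Finset.Ico (N + 1) (n + 1), (2 / R) ^ N * (R ^ j * ‖c j‖) := by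
          refine norm_sum_le_of_le _ fun j hj => ?_
          rw [Finset.mem_Ico] at hj
          rw [norm_smul, norm_pow, Real.norm_eq_abs, ← mul_assoc]
          gcongr
          calc |x i| ^ j ≤ 2 ^ j := pow_le_pow_left₀ (abs_nonneg _) (hx i hi) j
            _ = (2 / R) ^ j * R ^ j := by rw [← mul_pow, div_mul_cancel₀ _ hR0.ne']
            _ ≤ (2 / R) ^ N * R ^ j := by
              gcongr ?_ * _
              exact pow_le_pow_of_le_one (by positivity) ((div_le_one hR0).2 hR) (by omega)
      _ ≤ (2 / R) ^ N * ∑ j ∈ Finset.range (n + 1), R ^ j * ‖c j‖ := by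
          rw [← Finset.mul_sum]
          gcongr
          intro j hj
          exact Finset.mem_range.2 (Finset.mem_Ico.1 hj).2
      _ ≤ _ := by gcongr
  have h0 : y ^ n = c 0 := by
    have := hc 0
    rw [zero_smul, add_zero, Finset.sum_range_succ'] at this
    simpa using this
  have hP0 : c 0 = ∑ i ∈ Finset.range (N + 1), l i • P (x i) := by
    simp only [hP, Finset.smul_sum, smul_smul]
    rw [Finset.sum_comm]
    simp only [← Finset.sum_smul]
    rw [Finset.sum_congr rfl fun j hj => by
      rw [hl j (Nat.lt_succ_iff.1 (Finset.mem_range.1 hj))], Finset.sum_range_succ']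
    simp
  set E := D + (2 / R) ^ N * (‖(1 : A)‖ * (‖y‖ + R * ‖a‖) ^ n) with hE
  have hE0 : 0 ≤ E := by positivity
  rw [h0, hP0]
  calc ‖∑ i ∈ Finset.range (N + 1), l i • P (x i)‖
      ≤ ∑ i ∈ Finset.range (N + 1), |l i| * E := by
        refine norm_sum_le_of_le _ fun i hi => ?_
        have hi' := Nat.lt_succ_iff.1 (Finset.mem_range.1 hi)
        rw [norm_smul, Real.norm_eq_abs]
        gcongr
        have : P (x i) = (y + x i • a) ^ n - Q (x i) := by rw [hPQ]; abel
        rw [this]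
        exact (norm_sub_le _ _).trans (add_le_add (hnode i hi') (hQb i hi'))
    _ ≤ W * E := by rw [← Finset.sum_mul]; gcongr

end Extrapolation

theorem exists_separated_of_lt_volume (δ : ℝ≥0) (hδ : 0 < δ) (N : ℕ) :
    ∀ K : Set ℝ, BddBelow K → (2 * N * δ : ℝ≥0∞) < volume K →
      ∃ x : ℕ → ℝ, (∀ i ≤ N, x i ∈ K) ∧ ∀ i ≤ N, ∀ j ≤ N, i ≤ j → δ * ((j : ℝ) - i) ≤ x j - x i := by
  induction N with
  | zero =>
    intro K _ hK
    obtain ⟨s, hs⟩ := nonempty_of_measure_ne_zero (pos_of_gt hK).ne'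
    refine ⟨fun _ => s, fun _ _ => hs, fun i hi j hj _ => ?_⟩
    obtain rfl := Nat.le_zero.1 hi
    obtain rfl := Nat.le_zero.1 hj
    simp
  | succ N ih =>
    intro K hb hK
    have hne := nonempty_of_measure_ne_zero (pos_of_gt hK).ne'
    have hδ' : (0 : ℝ) < δ := hδ
    obtain ⟨s, hs, hsδ⟩ := exists_lt_of_csInf_lt hne (lt_add_of_pos_right (sInf K) hδ')
    have hsub : K ⊆ (K ∩ Set.Ici (s + δ)) ∪ Set.Ico (sInf K) (sInf K + 2 * δ) := by
      intro t ht
      by_cases h : s + δ ≤ t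
      · exact Or.inl ⟨ht, h⟩
      · exact Or.inr ⟨csInf_le hb ht, by linarith⟩
    have hvol : volume K ≤ volume (K ∩ Set.Ici (s + δ)) + 2 * δ := by
      refine (measure_mono hsub).trans ((measure_union_le _ _).trans ?_)
      rw [Real.volume_Ico, add_sub_cancel_left, ENNReal.ofReal_mul zero_le_two]
      simp
    have hK' : (2 * N * δ : ℝ≥0∞) < volume (K ∩ Set.Ici (s + δ)) := by
      have h1 := hK.trans_le hvol
      have h2 : (2 * ((N + 1 : ℕ) : ℝ≥0∞) * δ) = 2 * N * δ + 2 * δ := by push_cast; ring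
      rw [h2] at h1
      exact lt_of_add_lt_add_right h1
    obtain ⟨x, hxK, hx⟩ := ih _ (hb.mono Set.inter_subset_left) hK'
    refine ⟨fun i => if i = 0 then s else x (i - 1), fun i hi => ?_, fun i hi j hj hij => ?_⟩
    · by_cases h : i = 0
      · simpa [h] using hs
      · simp only [h, if_false]
        exact (hxK _ (by omega)).1
    · rcases Nat.eq_zero_or_pos i with rfl | hi0
      · rcases Nat.eq_zero_or_pos j with rfl | hj0
        · simp
        · obtain ⟨j, rfl⟩ := Nat.exists_eq_succ_of_ne_zero hj0.ne'
          have h1 := hx 0 (Nat.zero_le _) j (by omega) (Nat.zero_le _)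
          have h2 : s + δ ≤ x 0 := (hxK 0 (Nat.zero_le _)).2
          simp at h1 ⊢
          linarith
      · obtain ⟨j, rfl⟩ := Nat.exists_eq_succ_of_ne_zero (hi0.trans_le hij).ne'
        obtain ⟨i, rfl⟩ := Nat.exists_eq_succ_of_ne_zero hi0.ne'
        have h1 := hx i (by omega) j (by omega) (by omega)
        simp at h1 ⊢
        linarith

/-- An additive function vanishing at `1` is small on a set of large outer measure. -/
theorem half_le_volume_norm_additive_lt {B : Type*} [NormedAddCommGroup B] [NormedSpace ℝ B]
    (β : ℝ →+ B)
    (hβ : β 1 = 0) {ε : ℝ} (hε : 0 < ε) :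
    (1 / 2 : ℝ≥0∞) ≤ volume {s : ℝ | s ∈ Set.Ico (0 : ℝ) 1 ∧ ‖β s‖ < ε} := by
  let F : ℕ → Set ℝ := fun n => {s | s ∈ Set.Ico (0 : ℝ) 1 ∧ ‖β s‖ ≤ n}
  have hFmono : Monotone F := fun m n h s hs => ⟨hs.1, hs.2.trans (by exact_mod_cast h)⟩
  have hFU : ⋃ n, F n = Set.Ico (0 : ℝ) 1 := by
    ext s
    simp only [Set.mem_iUnion, F, Set.mem_ofPred_eq]
    exact ⟨fun ⟨_, h, _⟩ => h, fun h => (exists_nat_ge ‖β s‖).imp fun n hn => ⟨h, hn⟩⟩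
  obtain ⟨n, hn⟩ : ∃ n, (1 / 2 : ℝ≥0∞) < volume (F n) := by
    rw [← lt_iSup_iff, ← hFmono.measure_iUnion, hFU, Real.volume_Ico]
    simp [ENNReal.inv_lt_one]
  obtain ⟨m, hm⟩ := exists_nat_gt (n / ε)
  have hm0' : (0 : ℝ) < m := lt_of_le_of_lt (by positivity) hm
  have hm0 : 0 < m := by exact_mod_cast hm0'
  have hnm : (n : ℝ) / m < ε := by
    rw [div_lt_iff₀ hε] at hm
    rw [div_lt_iff₀ hm0']
    linarith
  set G : Set ℝ := {s : ℝ | s ∈ Set.Ico (0 : ℝ) 1 ∧ ‖β s‖ < ε} with hG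
  have hβnat : ∀ k : ℕ, β k = 0 := fun k => by
    rw [← nsmul_one, map_nsmul, hβ, smul_zero]
  have hpiece : ∀ k < m, ENNReal.ofReal (m : ℝ)⁻¹ * volume (F n)
      ≤ volume (G ∩ Set.Ico ((k : ℝ) / m) ((k + 1 : ℝ) / m)) := by
    intro k hk
    have hk' : (k : ℝ) + 1 ≤ m := by exact_mod_cast hk
    have h1 : volume ((fun x : ℝ => (m : ℝ) * x) ⁻¹' ((fun x : ℝ => -(k : ℝ) + x) ⁻¹' F n))
        = ENNReal.ofReal (m : ℝ)⁻¹ * volume (F n) := by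
      rw [Real.volume_preimage_mul_left hm0'.ne', measure_preimage_add,
        abs_of_pos (inv_pos.2 hm0')]
    rw [← h1]
    refine measure_mono fun x hx => ?_
    obtain ⟨⟨hx0, hx1⟩, hxn⟩ := hx
    have hk0 : (0 : ℝ) ≤ k := Nat.cast_nonneg k
    have hxl : (k : ℝ) / m ≤ x := by rw [div_le_iff₀ hm0']; linarith
    have hxu : x < ((k : ℝ) + 1) / m := by rw [lt_div_iff₀ hm0']; linarith
    refine ⟨⟨⟨le_trans (by positivity) hxl, hxu.trans_le ((div_le_one hm0').2 hk')⟩, ?_⟩, hxl, hxu⟩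
    have h2 : β (-(k : ℝ) + m * x) = (m : ℝ) • β x := by
      rw [map_add, map_neg, hβnat, neg_zero, zero_add, ← nsmul_eq_mul, map_nsmul,
        Nat.cast_smul_eq_nsmul]
    rw [h2, norm_smul, Real.norm_natCast] at hxn
    refine lt_of_le_of_lt ?_ hnm
    rwa [le_div_iff₀ hm0', mul_comm]
  have hsum : ∀ k ≤ m, k * (ENNReal.ofReal (m : ℝ)⁻¹ * volume (F n))
      ≤ volume (G ∩ Set.Iio ((k : ℝ) / m)) := by
    intro k
    induction k with
    | zero => simp
    | succ k ih =>
      intro hk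
      have h1 := ih (by omega)
      have h2 := hpiece k (by omega)
      have hle : (k : ℝ) / m ≤ ((k + 1 : ℕ) : ℝ) / m := by gcongr; omega
      rw [← measure_inter_add_sdiff (G ∩ Set.Iio (((k + 1 : ℕ) : ℝ) / m))
        (measurableSet_Iio (a := (k : ℝ) / m))]
      rw [Nat.cast_succ, add_mul, one_mul]
      refine add_le_add (h1.trans (measure_mono ?_)) (h2.trans (measure_mono ?_))
      · rintro s ⟨hs, hs'⟩
        exact ⟨⟨hs, lt_of_lt_of_le hs' hle⟩, hs'⟩
      · rintro s ⟨hs, hs', hs''⟩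
        exact ⟨⟨hs, hs''.trans_eq (by push_cast; rfl)⟩, not_lt.2 hs'⟩
  have h1 := (hsum m le_rfl).trans (measure_mono Set.inter_subset_left)
  rw [← mul_assoc, ENNReal.ofReal_inv_of_pos hm0', ENNReal.ofReal_natCast,
    ENNReal.mul_inv_cancel (by exact_mod_cast hm0.ne') (ENNReal.natCast_ne_top m), one_mul] at h1
  exact hn.le.trans h1

/-- The key inequality: translating by an element of the separating space of an additive
spectral-radius preserving map does not decrease the spectral radius. -/
theorem spectralRadius_le_add_of_mem_separating {A B : Type*}
    [NormedRing A] [NormedAlgebra ℂ A] [CompleteSpace A]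
    [NormedRing B] [NormedAlgebra ℂ B] [CompleteSpace B] (T : A →+ B)
    (hsurj : Function.Surjective T) (hr : ∀ x, spectralRadius ℂ (T x) = spectralRadius ℂ x)
    {b : B} (hb : ∀ ε > 0, ∃ a : A, ‖a‖ < ε ∧ ‖T a - b‖ < ε) (e : B) :
    spectralRadius ℂ e ≤ spectralRadius ℂ (e + b) := by
  obtain ⟨y, rfl⟩ := hsurj e
  by_contra! hlt
  rw [hr y] at hlt
  obtain ⟨m, hm, hmy⟩ := ENNReal.lt_iff_exists_nnreal_btwn.1 hlt
  obtain ⟨m', hm', hmy'⟩ := ENNReal.lt_iff_exists_nnreal_btwn.1 hmy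
  have hmpos : (0 : ℝ) < m := by exact_mod_cast pos_of_gt hm
  have hmm' : (m : ℝ) < m' := by exact_mod_cast hm'
  obtain ⟨ρ, hρ, hball⟩ := Metric.eventually_nhds_iff.1 (eventually_spectralRadius_lt hm)
  obtain ⟨p, hp⟩ := exists_nat_gt ((‖b‖ + 2) / (ρ / 2))
  have hp0 : (0 : ℝ) < p := lt_of_le_of_lt (by positivity) hp
  have hp1 : (1 : ℝ) ≤ p := by exact_mod_cast (show 0 < p by exact_mod_cast hp0)
  have hpρ : (p : ℝ)⁻¹ * (‖b‖ + 2) < ρ / 2 := by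
    rw [div_lt_iff₀ (by positivity)] at hp
    rw [inv_mul_lt_iff₀ hp0]
    linarith
  set C : ℝ := 32 * Real.exp 1 * p with hC
  have hCpos : 0 < C := by positivity
  obtain ⟨L, hL⟩ : ∃ L : ℕ, 2 * C * (m : ℝ) ^ (L + 1) ≤ (m' : ℝ) ^ (L + 1) := by
    obtain ⟨L, hL⟩ := pow_unbounded_of_one_lt (2 * C) ((one_lt_div hmpos).2 hmm')
    refine ⟨L, ?_⟩
    rw [← le_div_iff₀ (by positivity), ← div_pow]
    exact hL.le.trans (pow_le_pow_right₀ ((one_lt_div hmpos).2 hmm').le L.le_succ)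
  set K : ℝ := max 1 ‖(1 : A)‖ with hK
  have hK1 : 1 ≤ K := le_max_left _ _
  set M : ℝ := ‖y‖ + 1 with hM
  have hMpos : 0 < M := by positivity
  set R : ℝ := max 2 (2 * K * M ^ (L + 1) / (m : ℝ) ^ (L + 1)) with hRdef
  have hR2 : 2 ≤ R := le_max_left _ _
  have hR0 : 0 < R := by linarith
  have hRtail : 2 / R * K * M ^ (L + 1) ≤ (m : ℝ) ^ (L + 1) := by
    have h1 : 2 * K * M ^ (L + 1) / (m : ℝ) ^ (L + 1) ≤ R := le_max_right _ _
    rw [div_le_iff₀ (by positivity)] at h1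
    rw [div_mul_eq_mul_div, div_mul_eq_mul_div, div_le_iff₀ hR0]
    linarith
  obtain ⟨c, hcR, hcT⟩ := hb (min R⁻¹ (min 1 (ρ / 2))) (by positivity)
  have hRc : R * ‖c‖ ≤ 1 := by
    have h1 : ‖c‖ ≤ R⁻¹ := (hcR.trans_le (min_le_left _ _)).le
    calc R * ‖c‖ ≤ R * R⁻¹ := by gcongr
      _ = 1 := mul_inv_cancel₀ hR0.ne'
  have hcT1 : ‖T c - b‖ < 1 := hcT.trans_le ((min_le_right _ _).trans (min_le_left _ _))
  have hcTρ : ‖T c - b‖ < ρ / 2 := hcT.trans_le ((min_le_right _ _).trans (min_le_right _ _))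
  let β : ℝ →+ B :=
    { toFun := fun s => T (s • c) - s • T c
      map_zero' := by simp
      map_add' := fun s t => by rw [add_smul, map_add, add_smul]; abel }
  have hβ1 : β 1 = 0 := by simp [β]
  have hG := half_le_volume_norm_additive_lt β hβ1 one_pos
  have hnode : ∀ s : ℝ, s ∈ Set.Ico (0 : ℝ) 1 → ‖β s‖ < 1 →
      spectralRadius ℂ (y + (1 + (p : ℝ)⁻¹ * s) • c) < m := by
    intro s hs hβs
    have hTs : T (y + (1 + (p : ℝ)⁻¹ * s) • c) =
        T y + b + ((T c - b) + (p : ℝ)⁻¹ • (s • T c + β s)) := by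
      have h1 : T (((p : ℝ)⁻¹ * s) • c) = (p : ℝ)⁻¹ • T (s • c) := by
        rw [mul_smul, map_inv_natCast_smul T ℝ ℝ]
      have h2 : s • T c + β s = T (s • c) := by simp [β]
      rw [h2, ← h1, map_add, add_smul, one_smul, map_add]
      abel
    rw [← hr, hTs]
    apply hball
    rw [dist_eq_norm, add_sub_cancel_left]
    have hTc : ‖T c‖ ≤ ‖b‖ + 1 := by
      have := norm_sub_norm_le (T c) b
      linarith
    calc ‖(T c - b) + (p : ℝ)⁻¹ • (s • T c + β s)‖
        ≤ ‖T c - b‖ + ‖(p : ℝ)⁻¹ • (s • T c + β s)‖ := norm_add_le _ _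
      _ ≤ ‖T c - b‖ + (p : ℝ)⁻¹ * (‖b‖ + 2) := by
          rw [norm_smul, norm_inv, Real.norm_natCast]
          gcongr
          refine (norm_add_le _ _).trans ?_
          rw [norm_smul, Real.norm_of_nonneg hs.1]
          have : s * ‖T c‖ ≤ 1 * (‖b‖ + 1) :=
            mul_le_mul hs.2.le hTc (norm_nonneg _) zero_le_one
          linarith
      _ < ρ := by linarith
  let S : ℕ → Set ℝ := fun i => {s | s ∈ Set.Ico (0 : ℝ) 1 ∧
    ‖(y + (1 + (p : ℝ)⁻¹ * s) • c) ^ ((L + 1) * 2 ^ i)‖ ≤ (m : ℝ) ^ ((L + 1) * 2 ^ i)}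
  have hSmono : Monotone S := by
    refine monotone_nat_of_le_succ fun i s hs => ⟨hs.1, ?_⟩
    rw [pow_succ, ← mul_assoc, pow_mul, pow_mul (m : ℝ)]
    exact (norm_pow_le' _ two_pos).trans (pow_le_pow_left₀ (norm_nonneg _) hs.2 2)
  have htend : Tendsto (fun i : ℕ => (L + 1) * 2 ^ i) atTop atTop :=
    (tendsto_pow_atTop_atTop_of_one_lt one_lt_two).const_mul_atTop' L.succ_pos
  obtain ⟨i, hi⟩ : ∃ i, (1 / 4 : ℝ≥0∞) < volume (S i) := by
    rw [← lt_iSup_iff, ← hSmono.measure_iUnion]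
    refine lt_of_lt_of_le ?_ (hG.trans (measure_mono fun s hs => ?_))
    · rw [one_div, one_div, ENNReal.inv_lt_inv]
      norm_num
    · obtain ⟨i, hi⟩ := (htend.eventually
        (eventually_norm_pow_le_of_spectralRadius_lt (hnode s hs.1 hs.2))).exists
      exact Set.mem_iUnion.2 ⟨i, hs.1, hi⟩
  set N : ℕ := 2 ^ i with hN
  have hN0 : 0 < N := by positivity
  have hNr : (0 : ℝ) < N := by exact_mod_cast hN0
  set n : ℕ := (L + 1) * N with hn
  let δ : ℝ≥0 := (8 * N)⁻¹
  have hδ0 : 0 < δ := by positivity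
  have hδr : (δ : ℝ) = (8 * (N : ℝ))⁻¹ := by simp [δ]
  have h2Nδ : (2 * N * δ : ℝ≥0∞) < volume (S i) := by
    have h1 : 2 * (N : ℝ≥0) * δ = 1 / 4 := by
      have : (N : ℝ≥0) ≠ 0 := by exact_mod_cast hN0.ne'
      simp only [δ]
      field_simp
      norm_num
    have h2 : (2 * N * δ : ℝ≥0∞) = 1 / 4 := by
      calc (2 * N * δ : ℝ≥0∞) = ((2 * (N : ℝ≥0) * δ : ℝ≥0) : ℝ≥0∞) := by push_cast; rfl
        _ = 1 / 4 := by rw [h1]; simp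
    rwa [h2]
  obtain ⟨s, hsS, hsep⟩ := exists_separated_of_lt_volume δ hδ0 N (S i)
    ⟨0, fun s hs => hs.1.1⟩ h2Nδ
  let x : ℕ → ℝ := fun k => 1 + (p : ℝ)⁻¹ * s k
  have hx2 : ∀ k ≤ N, |x k| ≤ 2 := by
    intro k hk
    have h1 := (hsS k hk).1
    have h2 : (p : ℝ)⁻¹ * s k ≤ 1 * 1 :=
      mul_le_mul (inv_le_one_of_one_le₀ hp1) h1.2.le h1.1 zero_le_one
    have h3 : 0 ≤ (p : ℝ)⁻¹ * s k := mul_nonneg (by positivity) h1.1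
    rw [abs_of_nonneg] <;> simp only [x] <;> linarith
  have hsep' : ∀ k ≤ N, ∀ j ≤ N, (p : ℝ)⁻¹ * δ * |(k : ℝ) - j| ≤ |x k - x j| := by
    have key : ∀ k ≤ N, ∀ j ≤ N, k ≤ j → (p : ℝ)⁻¹ * δ * |(k : ℝ) - j| ≤ |x k - x j| := by
      intro k hk j hj hkj
      have h1 := hsep k hk j hj hkj
      have h2 : x j - x k = (p : ℝ)⁻¹ * (s j - s k) := by simp only [x]; ring
      rw [abs_sub_comm, abs_sub_comm (x k), h2, abs_mul, abs_of_pos (inv_pos.2 hp0), mul_assoc]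
      gcongr
      rw [abs_of_nonneg (sub_nonneg.2 (by exact_mod_cast hkj))]
      exact h1.trans (le_abs_self _)
    intro k hk j hj
    rcases le_total k j with h | h
    · exact key k hk j hj h
    · rw [abs_sub_comm, abs_sub_comm (x k)]
      exact key j hj k hk h
  obtain ⟨l, hl, hlW⟩ := exists_lagrange_weights N x (by positivity) hx2 hsep'
  have hW : ∑ k ∈ Finset.range (N + 1), |l k| ≤ C ^ N := by
    refine hlW.trans ?_
    have h1 : 4 / ((p : ℝ)⁻¹ * δ) = 32 * p * N := by
      rw [hδr]
      field_simp
      norm_num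
    have h2 := Real.pow_div_factorial_le_exp (N : ℝ) hNr.le N
    have h3 : C ^ N = (32 * (p : ℝ)) ^ N * Real.exp N := by
      rw [← Real.exp_one_pow, ← mul_pow, hC]
      ring
    rw [h1, h3, mul_pow, mul_div_assoc]
    gcongr
  have hfin := norm_pow_le_of_norm_pow_nodes_le y c hR2
    (show N ≤ n from Nat.le_mul_of_pos_left N L.succ_pos)
    (D := (m : ℝ) ^ n) (by positivity) hx2 hl hW (fun k hk => (hsS k hk).2)
  have htail : (2 / R) ^ N * (‖(1 : A)‖ * (‖y‖ + R * ‖c‖) ^ n) ≤ (m : ℝ) ^ n := by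
    calc (2 / R) ^ N * (‖(1 : A)‖ * (‖y‖ + R * ‖c‖) ^ n)
        ≤ (2 / R) ^ N * (K ^ N * M ^ n) := by
          gcongr
          · exact (le_max_right _ _).trans (le_self_pow₀ hK1 hN0.ne')
          · exact add_le_add le_rfl hRc
      _ = (2 / R * K * M ^ (L + 1)) ^ N := by
          rw [hn, pow_mul, mul_pow, mul_pow, mul_assoc]
      _ ≤ ((m : ℝ) ^ (L + 1)) ^ N := by gcongr
      _ = (m : ℝ) ^ n := by rw [hn, pow_mul]
  have hyn : ‖y ^ n‖ ≤ (m' : ℝ) ^ n := by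
    calc ‖y ^ n‖ ≤ C ^ N * ((m : ℝ) ^ n + (m : ℝ) ^ n) := hfin.trans (by gcongr)
      _ = 2 * (C ^ N * (m : ℝ) ^ n) := by ring
      _ ≤ 2 ^ N * (C ^ N * (m : ℝ) ^ n) := by
          gcongr
          exact le_self_pow₀ one_le_two hN0.ne'
      _ = (2 * C * (m : ℝ) ^ (L + 1)) ^ N := by
          rw [hn, pow_mul, mul_pow (2 * C), mul_pow 2 C, mul_assoc]
      _ ≤ ((m' : ℝ) ^ (L + 1)) ^ N := by gcongr
      _ = (m' : ℝ) ^ n := by rw [hn, pow_mul]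
  exact absurd (spectralRadius_le_of_norm_pow_le (Nat.mul_pos L.succ_pos hN0) hyn)
    (not_le.2 hmy')

section Radical

variable {A : Type*} [NormedRing A] [NormedAlgebra ℂ A]

/-- The additive subgroup of elements whose addition never changes the spectral radius. -/
def spectralRadiusInvariant (A : Type*) [NormedRing A] [NormedAlgebra ℂ A] : AddSubgroup A where
  carrier := {b | ∀ e, spectralRadius ℂ (e + b) = spectralRadius ℂ e}
  zero_mem' := fun e => by rw [add_zero]
  add_mem' := fun {b c} hb hc e => by rw [← add_assoc, hc, hb]
  neg_mem' := fun {b} hb e => by rw [← hb (e + -b), neg_add_cancel_right]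

theorem spectralRadius_units_conjugate (u : Aˣ) (x : A) :
    spectralRadius ℂ (u * x * ↑u⁻¹) = spectralRadius ℂ x := by
  simp only [spectralRadius, spectrum.units_conjugate]

theorem units_conjugate_mem_spectralRadiusInvariant {b : A} (hb : b ∈ spectralRadiusInvariant A)
    (u : Aˣ) : u * b * ↑u⁻¹ ∈ spectralRadiusInvariant A := by
  intro e
  have h : e + u * b * ↑u⁻¹ = u * (↑u⁻¹ * e * u + b) * ↑u⁻¹ := by
    simp [mul_add, add_mul, mul_assoc]
  have h2 := spectralRadius_units_conjugate u⁻¹ e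
  rw [inv_inv] at h2
  rw [h, spectralRadius_units_conjugate, hb, h2]

theorem spectralRadius_eq_zero_of_mem_spectralRadiusInvariant {b : A}
    (hb : b ∈ spectralRadiusInvariant A) : spectralRadius ℂ b = 0 := by
  have h := hb 0
  rwa [zero_add, spectrum.spectralRadius_zero] at h

theorem exists_mul_sub_one_mem {R : Type*} [Ring R] {M : Ideal R} (hM : M.IsMaximal) {d : R}
    (hd : d ∉ M) : ∃ z, z * d - 1 ∈ M := by
  have h1 := (Ideal.isMaximal_iff.1 hM).2 (M ⊔ Ideal.span {d}) d le_sup_left hd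
    (le_sup_right (a := M) (Ideal.mem_span_singleton_self d))
  obtain ⟨m, hm, w, hw, hmw⟩ := Submodule.mem_sup.1 h1
  obtain ⟨z, rfl⟩ := Ideal.mem_span_singleton'.1 hw
  refine ⟨z, ?_⟩
  rw [← hmw, sub_add_cancel_right]
  exact M.neg_mem hm

theorem smul_one_sub_notMem_of_spectralRadius_eq_zero {d : A} (hd : spectralRadius ℂ d = 0)
    {M : Ideal A} (hM : M ≠ ⊤) {μ : ℂ} (hμ : μ ≠ 0) : μ • (1 : A) - d ∉ M := by
  intro h
  have hu : IsUnit (algebraMap ℂ A μ - d) :=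
    spectrum.mem_resolventSet_of_spectralRadius_lt (by rw [hd]; simpa using hμ)
  rw [Algebra.algebraMap_eq_smul_one] at hu
  exact hM (Ideal.eq_top_of_isUnit_mem M h hu)

variable [CompleteSpace A]

theorem isClosed_spectralRadiusInvariant :
    IsClosed (spectralRadiusInvariant A : Set A) := by
  refine isClosed_of_closure_subset fun c hc e => ?_
  have hle : ∀ e' c' : A, c' ∈ closure (spectralRadiusInvariant A : Set A) →
      spectralRadius ℂ e' ≤ spectralRadius ℂ (e' + c') := by
    intro e' c' hc'
    by_contra! hlt
    obtain ⟨m, hm, hme⟩ := ENNReal.lt_iff_exists_nnreal_btwn.1 hlt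
    have hcont : Tendsto (fun w => e' + w) (𝓝 c') (𝓝 (e' + c')) :=
      (continuous_const.add continuous_id).tendsto c'
    obtain ⟨w, hw, hwR⟩ := mem_closure_iff_nhds.1 hc' _
      (hcont.eventually (eventually_spectralRadius_lt hm))
    have hw' : spectralRadius ℂ (e' + w) < m := hw
    rw [hwR e'] at hw'
    exact absurd hw' (not_lt.2 hme.le)
  refine le_antisymm ?_ (hle e c hc)
  have hneg : -c ∈ closure (spectralRadiusInvariant A : Set A) :=
    (spectralRadiusInvariant A).topologicalClosure.neg_mem hc
  simpa using hle (e + c) (-c) hneg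

theorem commutator_mem_spectralRadiusInvariant {b : A} (hb : b ∈ spectralRadiusInvariant A)
    (x : A) : x * b - b * x ∈ spectralRadiusInvariant A := by
  let v : ℕ → A := fun k => 1 + (k : ℂ)⁻¹ • x
  have hv : Tendsto v atTop (𝓝 1) := by
    have h : Tendsto (fun k : ℕ => (k : ℂ)⁻¹) atTop (𝓝 0) := tendsto_inv_atTop_nhds_zero_nat
    simpa [v] using (h.smul_const x).const_add (1 : A)
  have hinv : Tendsto (fun k => (x * b - b * x) * Ring.inverse (v k)) atTop
      (𝓝 (x * b - b * x)) := by
    have h := (NormedRing.inverse_continuousAt (1 : Aˣ)).tendsto.comp hv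
    simpa using h.const_mul (x * b - b * x)
  refine isClosed_spectralRadiusInvariant.mem_of_tendsto hinv ?_
  filter_upwards [hv.eventually (Units.nhds 1), eventually_gt_atTop 0] with k hk hk0
  obtain ⟨u, hu⟩ := hk
  have hk0' : (k : ℂ) ≠ 0 := by exact_mod_cast hk0.ne'
  have h := (spectralRadiusInvariant A).nsmul_mem ((spectralRadiusInvariant A).sub_mem
    (units_conjugate_mem_spectralRadiusInvariant hb u) hb) k
  have hcomm : x * b - b * x = k • ((u : A) * b - b * u) := by
    rw [hu, ← Nat.cast_smul_eq_nsmul ℂ]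
    simp only [v, add_mul, mul_add, one_mul, mul_one, smul_mul_assoc, mul_smul_comm]
    rw [add_sub_add_left_eq_sub, ← smul_sub, smul_smul, mul_inv_cancel₀ hk0', one_smul]
  have heq : (x * b - b * x) * Ring.inverse (v k) = k • ((u : A) * b * ↑u⁻¹ - b) := by
    rw [← hu, Ring.inverse_unit, hcomm, smul_mul_assoc, sub_mul, Units.mul_inv_cancel_right]
  rw [heq]
  exact h

/-- An element idealizing a maximal left ideal acts on the quotient as a scalar. -/
theorem exists_sub_smul_one_mem_of_mul_mem {M : Ideal A} (hM : M.IsMaximal) {b : A}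
    (hb : ∀ m ∈ M, m * b ∈ M) : ∃ μ : ℂ, b - μ • (1 : A) ∈ M := by
  let S : Submodule ℂ A := M.restrictScalars ℂ
  have hS : IsClosed (S : Set A) := hM.isClosed
  have hmemS : ∀ {a : A}, a ∈ S ↔ a ∈ M := Iff.rfl
  have : Nontrivial (A ⧸ S) := by
    refine Submodule.Quotient.nontrivial_iff.2 fun h => hM.ne_top ?_
    rw [Ideal.eq_top_iff_one, ← hmemS, h]
    trivial
  let φ : ∀ d : A, (∀ m ∈ M, m * d ∈ M) → (A ⧸ S) →L[ℂ] (A ⧸ S) := fun d hd =>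
    S.liftQL (S.mkQL.comp ((ContinuousLinearMap.mul ℂ A).flip d)) fun m hm => by
      simpa [Submodule.Quotient.mk_eq_zero, hmemS] using hd m hm
  have hφ : ∀ d hd (a : A), φ d hd (Submodule.Quotient.mk a) = Submodule.Quotient.mk (a * d) :=
    fun d hd a => rfl
  obtain ⟨μ, hμ⟩ := spectrum.nonempty (φ b hb)
  refine ⟨μ, by_contra fun hd => hμ ?_⟩
  set d := b - μ • (1 : A) with hddef
  have hdM : ∀ m ∈ M, m * d ∈ M := fun m hm => by
    rw [hddef, mul_sub, mul_smul_comm, mul_one]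
    exact M.sub_mem (hb m hm) (S.smul_mem μ hm)
  obtain ⟨z, hz⟩ := exists_mul_sub_one_mem hM hd
  have hker : ∀ a, a * d ∈ M → a ∈ M := by
    intro a ha
    by_contra haM
    obtain ⟨w, hw⟩ := exists_mul_sub_one_mem hM haM
    refine hd ?_
    have h1 : d = w * (a * d) - (w * a - 1) * d := by noncomm_ring
    rw [h1]
    exact M.sub_mem (M.mul_mem_left w ha) (hdM _ hw)
  have hzM : ∀ m ∈ M, m * z ∈ M := fun m hm => hker _ (by
    have h1 : m * z * d = m * (z * d - 1) + m := by noncomm_ring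
    rw [h1]
    exact M.add_mem (M.mul_mem_left m hz) hm)
  have hdz : d * z - 1 ∈ M := hker _ (by
    have h1 : (d * z - 1) * d = d * (z * d - 1) := by noncomm_ring
    rw [h1]
    exact M.mul_mem_left d hz)
  have hφd : algebraMap ℂ ((A ⧸ S) →L[ℂ] (A ⧸ S)) μ - φ b hb = -φ d hdM := by
    ext v
    obtain ⟨a, rfl⟩ := Submodule.Quotient.mk_surjective S v
    rw [Algebra.algebraMap_eq_smul_one]
    simp only [sub_apply, smul_apply,
      one_apply_eq_self, neg_apply, hφ]
    rw [← Submodule.Quotient.mk_smul, ← Submodule.Quotient.mk_sub, ← Submodule.Quotient.mk_neg]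
    congr 1
    rw [hddef, mul_sub, mul_smul_comm, mul_one, neg_sub]
  have hunit : IsUnit (φ d hdM) := by
    refine ⟨⟨φ d hdM, φ z hzM, ?_, ?_⟩, rfl⟩
    · ext v
      obtain ⟨a, rfl⟩ := Submodule.Quotient.mk_surjective S v
      rw [mul_apply_eq_comp, hφ z hzM, hφ d hdM, one_apply_eq_self,
        Submodule.Quotient.eq, hmemS]
      have h1 : a * z * d - a = a * (z * d - 1) := by noncomm_ring
      rw [h1]
      exact M.mul_mem_left a hz
    · ext v
      obtain ⟨a, rfl⟩ := Submodule.Quotient.mk_surjective S v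
      rw [mul_apply_eq_comp, hφ d hdM, hφ z hzM, one_apply_eq_self,
        Submodule.Quotient.eq, hmemS]
      have h1 : a * d * z - a = a * (d * z - 1) := by noncomm_ring
      rw [h1]
      exact M.mul_mem_left a hdz
  rw [spectrum.mem_resolventSet_iff, hφd]
  exact hunit.neg

theorem mem_jacobson_bot_of_mem_spectralRadiusInvariant {b : A}
    (hb : b ∈ spectralRadiusInvariant A) : b ∈ Ideal.jacobson (⊥ : Ideal A) := by
  refine Submodule.mem_sInf.2 fun (M : Ideal A) hM => ?_
  have hMax : M.IsMaximal := hM.2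
  have hidealize : ∀ m ∈ M, m * b ∈ M := by
    intro m hm
    by_contra hmb
    obtain ⟨z, hz⟩ := exists_mul_sub_one_mem hMax hmb
    refine smul_one_sub_notMem_of_spectralRadius_eq_zero
      (spectralRadius_eq_zero_of_mem_spectralRadiusInvariant
        (commutator_mem_spectralRadiusInvariant hb (z * m))) hMax.ne_top one_ne_zero ?_
    have h1 : (1 : ℂ) • (1 : A) - (z * m * b - b * (z * m)) =
        (b * z) * m - (z * (m * b) - 1) := by
      rw [one_smul]
      noncomm_ring
    rw [h1]
    exact M.sub_mem (M.mul_mem_left _ hm) hz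
  obtain ⟨μ, hμ⟩ := exists_sub_smul_one_mem_of_mul_mem hMax hidealize
  rcases eq_or_ne μ 0 with rfl | hμ0
  · simpa using hμ
  · refine absurd (M.neg_mem hμ) ?_
    rw [neg_sub]
    exact smul_one_sub_notMem_of_spectralRadius_eq_zero
      (spectralRadius_eq_zero_of_mem_spectralRadiusInvariant hb) hMax.ne_top hμ0

end Radical

theorem eq_zero_of_mem_separating {A B : Type*}
    [NormedRing A] [NormedAlgebra ℂ A] [CompleteSpace A]
    [NormedRing B] [NormedAlgebra ℂ B] [CompleteSpace B]
    (hB : Ideal.jacobson (⊥ : Ideal B) = ⊥) (T : A →+ B)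
    (hsurj : Function.Surjective T) (hr : ∀ x, spectralRadius ℂ (T x) = spectralRadius ℂ x)
    {u : ℕ → A} {b : B} (hu : Tendsto u atTop (𝓝 0))
    (hTu : Tendsto (fun n => T (u n)) atTop (𝓝 b)) : b = 0 := by
  have hsep : ∀ ε > 0, ∃ a : A, ‖a‖ < ε ∧ ‖T a - b‖ < ε := by
    intro ε hε
    obtain ⟨n, h1, h2⟩ := ((Metric.tendsto_nhds.1 hu ε hε).and
      (Metric.tendsto_nhds.1 hTu ε hε)).exists
    exact ⟨u n, by simpa using h1, by simpa [dist_eq_norm] using h2⟩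
  have hsep' : ∀ ε > 0, ∃ a : A, ‖a‖ < ε ∧ ‖T a - -b‖ < ε := by
    intro ε hε
    obtain ⟨a, h1, h2⟩ := hsep ε hε
    refine ⟨-a, by rwa [norm_neg], ?_⟩
    rwa [map_neg, ← neg_sub', norm_neg]
  have hmem : b ∈ spectralRadiusInvariant B := fun e => le_antisymm
    (by simpa using spectralRadius_le_add_of_mem_separating T hsurj hr hsep' (e + b))
    (spectralRadius_le_add_of_mem_separating T hsurj hr hsep e)
  simpa [hB] using mem_jacobson_bot_of_mem_spectralRadiusInvariant hmem

end SpectralRadiusPreserver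

/-- A surjective additive spectral-radius preserving map between complex unital Banach
algebras with semisimple codomain is continuous. -/
theorem continuous_of_additive_spectralRadius_preserving_codomain_semisimple
    {A B : Type*} [NormedRing A] [NormedAlgebra ℂ A] [CompleteSpace A]
    [NormedRing B] [NormedAlgebra ℂ B] [CompleteSpace B]
    (hB : Ideal.jacobson (⊥ : Ideal B) = ⊥)
    (T : A → B)
    (hsurj : Function.Surjective T)
    (hadd : ∀ x y : A, T (x + y) = T x + T y)
    (hr : ∀ x : A, spectralRadius ℂ (T x) = spectralRadius ℂ x) :
    Continuous T := by
  let T' : A →+ B := AddMonoidHom.mk' T hadd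
  have hsmul : ∀ (t : ℝ) (x : A), T' (t • x) = t • T' x := by
    intro t x
    obtain ⟨q, -, -, hq⟩ := Real.exists_seq_rat_strictMono_tendsto t
    have hu : Tendsto (fun n => (t - (q n : ℝ)) • x) atTop (𝓝 0) := by
      simpa using (hq.const_sub t).smul_const x
    have hTu : Tendsto (fun n => T' ((t - (q n : ℝ)) • x)) atTop (𝓝 (T' (t • x) - t • T' x)) := by
      refine ((hq.smul_const (T' x)).const_sub (T' (t • x))).congr fun n => ?_
      rw [sub_smul, map_sub, map_ratCast_smul T' ℝ ℝ]
    exact sub_eq_zero.1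
      (SpectralRadiusPreserver.eq_zero_of_mem_separating hB T' hsurj hr hu hTu)
  let TL : A →ₗ[ℝ] B := { T' with map_smul' := hsmul }
  refine TL.continuous_of_seq_closed_graph fun u x y hux huy => ?_
  have hu : Tendsto (fun n => u n - x) atTop (𝓝 0) := by simpa using hux.sub_const x
  have hTu : Tendsto (fun n => T' (u n - x)) atTop (𝓝 (y - T' x)) := by
    refine (huy.sub_const (T' x)).congr fun n => ?_
    rw [map_sub]
    rfl
  exact sub_eq_zero.1 (SpectralRadiusPreserver.eq_zero_of_mem_separating hB T' hsurj hr hu hTu)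
end

section
/- Let A and B be complex unital Banach algebras with A semisimple, and let T : A → B be a surjective additive map with σ(Tx) = σ(x) for all x ∈ A. Then there exist constants α > 0 and β > 0 such that α‖x‖ ≤ ‖Tx‖ ≤ β‖x‖ for all x ∈ A. -/
open Filter Topology

open Real Metric in
/-- Subharmonicity of `‖g‖ ^ p` for an entire function `g`. -/
theorem norm_rpow_le_circleAverage {g : ℂ → ℂ} (hg : Differentiable ℂ g) {p : ℝ} (hp : 0 < p) :
    ‖g 0‖ ^ p ≤ circleAverage (fun w ↦ ‖g w‖ ^ p) 0 1 := by
  by_cases h0 : g 0 = 0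
  · rw [h0, norm_zero, zero_rpow hp.ne']
    exact circleAverage_nonneg_of_nonneg fun x _ ↦ by positivity
  have ha : ∀ s, AnalyticOnNhd ℂ g s := fun s x _ ↦ hg.analyticAt x
  have hlog : Real.log ‖g 0‖ ≤ circleAverage (fun w ↦ Real.log ‖g w‖) 0 1 := by
    rw [AnalyticOnNhd.circleAverage_log_norm one_ne_zero (ha _) h0]
    refine le_add_of_nonneg_left (finsum_nonneg fun u ↦ ?_)
    by_cases hu : u ∈ closedBall (0 : ℂ) |1|
    · refine mul_nonneg (by exact_mod_cast MeromorphicOn.AnalyticOnNhd.divisor_nonneg (ha _) u) ?_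
      rw [abs_one, mem_closedBall_zero_iff] at hu
      rw [zero_sub, norm_neg, one_mul]
      rcases eq_or_ne u 0 with rfl | hu0
      · simp
      · exact Real.log_nonneg ((one_le_inv₀ (norm_pos_iff.2 hu0)).2 hu)
    · rw [Function.locallyFinsuppWithin.apply_eq_zero_of_notMem _ hu]; simp
  set m := ‖g 0‖ ^ p with hm
  have hm0 : 0 < m := by have := norm_pos_iff.2 h0; positivity
  let u : ℂ → ℝ := fun w ↦ m⁻¹ * ‖g w‖ ^ p + (Real.log m - 1)
  let l : ℂ → ℝ := fun w ↦ p * Real.log ‖g w‖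
  let l' : ℂ → ℝ := fun w ↦ if g w = 0 then u w else l w
  have hcod : l =ᶠ[codiscreteWithin (sphere 0 |1|)] l' := by
    have := (ha Set.univ).preimage_zero_mem_codiscrete h0
    filter_upwards [codiscreteWithin_mono (Set.subset_univ _) this] with w hw
    simp only [l', if_neg (show ¬ g w = 0 from hw)]
  have hlint : CircleIntegrable l 0 1 :=
    (MeromorphicOn.circleIntegrable_log_norm fun z _ ↦ (hg.analyticAt z).meromorphicAt).const_mul p
  have hpint : CircleIntegrable (fun w ↦ ‖g w‖ ^ p) 0 1 :=
    ContinuousOn.circleIntegrable' ((hg.continuous.norm.rpow_const fun _ ↦ Or.inr hp.le).continuousOn)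
  have huint : CircleIntegrable u 0 1 :=
    (hpint.const_mul m⁻¹).add (circleIntegrable_const (Real.log m - 1) 0 1)
  have hle : circleAverage l' 0 1 ≤ circleAverage u 0 1 := by
    refine circleAverage_mono (hlint.congr_codiscreteWithin hcod) huint fun w _ ↦ ?_
    by_cases hw : g w = 0
    · simp [l', hw]
    · have hw' := norm_pos_iff.2 hw
      simp only [l', if_neg hw, l, u]
      have := Real.log_le_sub_one_of_pos (x := m⁻¹ * ‖g w‖ ^ p) (by positivity)
      rw [Real.log_mul (by positivity) (by positivity), Real.log_inv, Real.log_rpow hw'] at this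
      linarith
  rw [← circleAverage_congr_codiscreteWithin hcod one_ne_zero] at hle
  have h1 : circleAverage l 0 1 = p * circleAverage (fun w ↦ Real.log ‖g w‖) 0 1 := by
    simpa only [smul_eq_mul] using circleAverage_fun_smul (a := p) (f := fun w ↦ Real.log ‖g w‖)
  have h2 : circleAverage u 0 1 = m⁻¹ * circleAverage (fun w ↦ ‖g w‖ ^ p) 0 1 + (Real.log m - 1) := by
    rw [circleAverage_fun_add (f₁ := fun w ↦ m⁻¹ * ‖g w‖ ^ p) (hpint.const_mul m⁻¹)
        (circleIntegrable_const _ _ _),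
      circleAverage_const]
    congr 1
    simpa only [smul_eq_mul] using circleAverage_fun_smul (a := m⁻¹) (f := fun w ↦ ‖g w‖ ^ p)
  have h3 : Real.log m = p * Real.log ‖g 0‖ := Real.log_rpow (norm_pos_iff.2 h0) p
  have h4 := mul_le_mul_of_nonneg_left hlog hp.le
  rw [h1, h2] at hle
  have h5 : 1 ≤ m⁻¹ * circleAverage (fun w ↦ ‖g w‖ ^ p) 0 1 := by linarith
  rwa [inv_mul_eq_div, one_le_div hm0] at h5

open MeasureTheory Metric in
/-- The area mean value inequality follows from the circle mean value inequality. -/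
theorem volume_mul_le_setIntegral {G : ℂ → ℝ} (hG : Continuous G)
    (h : ∀ ζ : ℂ, G 0 ≤ Real.circleAverage (fun w ↦ G (w * ζ)) 0 1) :
    volume.real (closedBall (0 : ℂ) 1) * G 0 ≤ ∫ ζ in closedBall (0 : ℂ) 1, G ζ := by
  have h_integrable : ∀ F : ℂ → ℝ, Continuous F → IntegrableOn F (closedBall (0 : ℂ) 1) := fun F hF ↦
    hF.continuousOn.integrableOn_compact (isCompact_closedBall _ _)
  have hrot : ∀ θ : ℝ, ∫ ζ in closedBall (0 : ℂ) 1, G (circleMap 0 1 θ * ζ) =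
      ∫ ζ in closedBall (0 : ℂ) 1, G ζ := by
    intro θ
    have hmp := (rotation (Circle.exp θ)).measurePreserving
    have hpre : rotation (Circle.exp θ) ⁻¹' closedBall (0 : ℂ) 1 = closedBall 0 1 := by
      ext; simp only [Set.mem_preimage, mem_closedBall_zero_iff, LinearIsometryEquiv.norm_map]
    have := hmp.setIntegral_preimage_emb
      (rotation (Circle.exp θ)).toHomeomorph.measurableEmbedding G (closedBall 0 1)
    rw [hpre] at this
    rw [← this]
    simp [circleMap]
  have hcont : Continuous fun p : ℂ × ℝ ↦ G (circleMap 0 1 p.2 * p.1) := by fun_prop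
  have havg : ∀ ζ, Real.circleAverage (fun w ↦ G (w * ζ)) 0 1 =
      (2 * Real.pi)⁻¹ * ∫ θ in (0 : ℝ)..2 * Real.pi, G (circleMap 0 1 θ * ζ) := fun ζ ↦ rfl
  calc volume.real (closedBall (0 : ℂ) 1) * G 0 = ∫ ζ in closedBall (0 : ℂ) 1, G 0 := by simp
    _ ≤ ∫ ζ in closedBall (0 : ℂ) 1,
          (2 * Real.pi)⁻¹ * ∫ θ in (0 : ℝ)..2 * Real.pi, G (circleMap 0 1 θ * ζ) := by
        refine integral_mono (h_integrable _ continuous_const) (h_integrable _ ?_) fun ζ ↦ (h ζ).trans_eq (havg ζ)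
        exact (intervalIntegral.continuous_parametric_intervalIntegral_of_continuous'
          (f := fun ζ θ ↦ G (circleMap 0 1 θ * ζ)) hcont _ _).const_mul _
    _ = (2 * Real.pi)⁻¹ * ∫ θ in (0 : ℝ)..2 * Real.pi,
          ∫ ζ in closedBall (0 : ℂ) 1, G (circleMap 0 1 θ * ζ) := by
        rw [integral_const_mul]
        congr 1
        simp only [intervalIntegral.integral_of_le Real.two_pi_pos.le]
        refine integral_integral_swap ?_
        rw [Measure.prod_restrict]
        exact (hcont.continuousOn.integrableOn_compact
          ((isCompact_closedBall _ _).prod isCompact_Icc)).mono_set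
          (Set.prod_mono le_rfl Set.Ioc_subset_Icc_self)
    _ = ∫ ζ in closedBall (0 : ℂ) 1, G ζ := by
        simp only [hrot, intervalIntegral.integral_const, sub_zero, smul_eq_mul]
        field_simp

/-- The spectral radius of an element of a complex Banach algebra, as a real number. -/
noncomputable def spectralRadiusReal {A : Type*} [NormedRing A] [NormedAlgebra ℂ A] (a : A) : ℝ :=
  (spectralRadius ℂ a).toReal

namespace spectralRadiusReal

variable {A : Type*} [NormedRing A] [NormedAlgebra ℂ A]

theorem nonneg (a : A) : 0 ≤ spectralRadiusReal a := ENNReal.toReal_nonneg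

theorem norm_pow_rpow_le {R : Type*} [NormedRing R] (a : R) {n : ℕ} (hn : 0 < n) : ‖a ^ n‖ ^ (1 / n : ℝ) ≤ ‖a‖ := by
  have h := Real.rpow_le_rpow (norm_nonneg _) (norm_pow_le' a hn) (by positivity : 0 ≤ (1 / n : ℝ))
  rwa [one_div, Real.pow_rpow_inv_natCast (norm_nonneg _) hn.ne', ← one_div] at h

open Real in
theorem norm_pow_rpow_le_circleAverage (b v : A) {n : ℕ} (hn : 0 < n) :
    ‖b ^ n‖ ^ (1 / n : ℝ) ≤ circleAverage (fun w ↦ ‖(b + w • v) ^ n‖ ^ (1 / n : ℝ)) 0 1 := by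
  obtain ⟨φ, hφ, hb⟩ := exists_dual_vector'' ℂ (b ^ n)
  have hn' : (0 : ℝ) < 1 / n := by positivity
  have hd : Differentiable ℂ fun w : ℂ ↦ (b + w • v) ^ n := by fun_prop
  have h := norm_rpow_le_circleAverage (g := fun w ↦ φ ((b + w • v) ^ n))
    (φ.differentiable.comp hd) hn'
  simp only [zero_smul, add_zero, hb] at h
  rw [RCLike.norm_ofReal, abs_norm] at h
  refine h.trans (circleAverage_mono ?_ ?_ fun w _ ↦ ?_)
  · exact ContinuousOn.circleIntegrable' (((φ.continuous.comp hd.continuous).norm.rpow_const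
      fun _ ↦ Or.inr hn'.le).continuousOn)
  · exact ContinuousOn.circleIntegrable' ((hd.continuous.norm.rpow_const
      fun _ ↦ Or.inr hn'.le).continuousOn)
  · refine Real.rpow_le_rpow (norm_nonneg _) ?_ hn'.le
    exact (φ.le_opNorm _).trans (mul_le_of_le_one_left (norm_nonneg _) hφ)

theorem continuous_norm_pow_rpow (b v : A) (n : ℕ) :
    Continuous fun ζ : ℂ ↦ ‖(b + ζ • v) ^ n‖ ^ (1 / n : ℝ) :=
  Continuous.rpow_const (by fun_prop) fun _ ↦ Or.inr (by positivity)

theorem eq_zero_of_isUnit {a : A} (h : ∀ μ : ℂ, IsUnit (1 + μ • a)) :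
    spectralRadiusReal a = 0 := by
  have h0 : spectralRadius ℂ a = 0 := by
    refine le_antisymm (iSup₂_le fun k hk ↦ ?_) bot_le
    rcases eq_or_ne k 0 with rfl | hk0
    · simp
    · refine absurd ?_ (spectrum.mem_iff.mp hk)
      have h2 : algebraMap ℂ A k - a = algebraMap ℂ A k * (1 + (-k⁻¹) • a) := by
        rw [← Algebra.smul_def, smul_add, smul_smul, Algebra.algebraMap_eq_smul_one]
        simp [hk0, sub_eq_add_neg]
      rw [h2]
      exact ((IsUnit.mk0 k hk0).map (algebraMap ℂ A)).mul (h _)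
  simp [spectralRadiusReal, h0]

variable [CompleteSpace A]

theorem spectralRadius_le_norm (a : A) : spectralRadius ℂ a ≤ ENNReal.ofReal ‖a‖ := by
  refine le_of_tendsto (spectrum.pow_norm_pow_one_div_tendsto_nhds_spectralRadius a) ?_
  filter_upwards [eventually_gt_atTop 0] with n hn
  exact ENNReal.ofReal_le_ofReal (norm_pow_rpow_le a hn)

theorem spectralRadius_ne_top (a : A) : spectralRadius ℂ a ≠ ⊤ :=
  ne_top_of_le_ne_top ENNReal.ofReal_ne_top (spectralRadius_le_norm a)

theorem le_norm (a : A) : spectralRadiusReal a ≤ ‖a‖ :=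
  ENNReal.toReal_le_of_le_ofReal (norm_nonneg _) (spectralRadius_le_norm a)

theorem tendsto_norm_pow_rpow (a : A) :
    Tendsto (fun n : ℕ ↦ ‖a ^ n‖ ^ (1 / n : ℝ)) atTop (𝓝 (spectralRadiusReal a)) := by
  refine ((ENNReal.tendsto_toReal (spectralRadius_ne_top a)).comp
    (spectrum.pow_norm_pow_one_div_tendsto_nhds_spectralRadius a)).congr fun n ↦ ?_
  exact ENNReal.toReal_ofReal (by positivity)

theorem pow (a : A) {k : ℕ} (hk : 0 < k) :
    spectralRadiusReal (a ^ k) = spectralRadiusReal a ^ k := by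
  have h : Tendsto (fun n : ℕ ↦ k * n) atTop atTop := tendsto_id.const_mul_atTop' hk
  refine tendsto_nhds_unique (tendsto_norm_pow_rpow (a ^ k))
    ((((tendsto_norm_pow_rpow a).comp h).pow k).congr fun n ↦ ?_)
  have hk' : (k : ℝ) ≠ 0 := by positivity
  rw [Function.comp_apply, ← pow_mul, ← Real.rpow_mul_natCast (norm_nonneg _)]
  congr 1
  push_cast
  rcases eq_or_ne n 0 with rfl | hn
  · simp
  · field_simp

theorem smul (c : ℂ) (a : A) : spectralRadiusReal (c • a) = ‖c‖ * spectralRadiusReal a := by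
  refine tendsto_nhds_unique (tendsto_norm_pow_rpow (c • a))
    (((tendsto_norm_pow_rpow a).const_mul ‖c‖).congr' ?_)
  filter_upwards [eventually_ne_atTop 0] with n hn
  rw [smul_pow, norm_smul, norm_pow c, Real.mul_rpow (by positivity) (by positivity), one_div,
    Real.pow_rpow_inv_natCast (norm_nonneg _) hn]

theorem le_of_norm_pow_le {a : A} {M : ℝ} (hM : 0 ≤ M) {n : ℕ} (hn : 0 < n)
    (h : ‖a ^ n‖ ≤ M ^ n) : spectralRadiusReal a ≤ M := by
  refine le_of_pow_le_pow_left₀ hn.ne' hM ?_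
  rw [← pow a hn]
  exact (le_norm _).trans h

theorem mono_of_spectrum_subset {B : Type*} [NormedRing B] [NormedAlgebra ℂ B] {a : A} {b : B}
    (h : spectrum ℂ b ⊆ spectrum ℂ a) : spectralRadiusReal b ≤ spectralRadiusReal a :=
  ENNReal.toReal_mono (spectralRadius_ne_top a) (biSup_mono h)

theorem isUnit_one_add {a : A} (h : spectralRadiusReal a < 1) : IsUnit (1 + a) := by
  by_contra hu
  have hmem : (-1 : ℂ) ∈ spectrum ℂ a := by
    rw [spectrum.mem_iff]
    intro h'
    refine hu ?_
    rw [← IsUnit.neg_iff]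
    convert h' using 1
    simp
    abel
  have h1 : (‖(-1 : ℂ)‖₊ : ENNReal) ≤ spectralRadius ℂ a :=
    le_iSup₂ (f := fun (k : ℂ) (_ : k ∈ spectrum ℂ a) ↦ (‖k‖₊ : ENNReal)) _ hmem
  have h2 := ENNReal.toReal_mono (spectralRadius_ne_top a) h1
  simp only [nnnorm_neg, nnnorm_one, ENNReal.coe_one, ENNReal.toReal_one] at h2
  exact absurd h2 (not_le.mpr h)

open Complex Metric Set in
/-- The maximum principle for the spectral radius of a holomorphic family. -/
theorem le_of_forall_mem_frontier_le {f : ℂ → A} {U : Set ℂ} (hU : Bornology.IsBounded U)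
    (hf : DiffContOnCl ℂ f U) {M : ℝ} (hM : ∀ w ∈ frontier U, spectralRadiusReal (f w) ≤ M)
    {w : ℂ} (hw : w ∈ closure U) : spectralRadiusReal (f w) ≤ M := by
  have hMnn : 0 ≤ M := by
    have hne : (frontier U).Nonempty := by
      rw [nonempty_frontier_iff]
      refine ⟨closure_nonempty_iff.mp ⟨w, hw⟩, ?_⟩
      rintro rfl
      exact NormedSpace.unbounded_univ ℂ ℂ hU
    obtain ⟨u, hu⟩ := hne
    exact (nonneg _).trans (hM u hu)
  refine le_of_forall_gt_imp_ge_of_dense fun M' hM' ↦ ?_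
  have hM'pos : 0 < M' := hMnn.trans_lt hM'
  have hcont : ContinuousOn f (frontier U) := hf.continuousOn.mono frontier_subset_closure
  have hcpt : IsCompact (frontier U) :=
    isCompact_of_isClosed_isBounded isClosed_frontier (hU.closure.subset frontier_subset_closure)
  have key : ∃ n : ℕ, ∀ u ∈ frontier U, ‖f u ^ 2 ^ n‖ < M' ^ 2 ^ n := by
    by_contra! hcon
    choose u hu hbad using hcon
    obtain ⟨v, hv, φ, hφ, hlim⟩ := hcpt.tendsto_subseq hu
    have hmono : ∀ (x : A) (m k : ℕ), ‖x ^ 2 ^ m‖ < M' ^ 2 ^ m →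
        ‖x ^ 2 ^ (m + k)‖ < M' ^ 2 ^ (m + k) := by
      intro x m k h
      rw [pow_add, pow_mul, pow_mul]
      exact (norm_pow_le' _ (by positivity)).trans_lt
        (pow_lt_pow_left₀ h (norm_nonneg _) (by positivity))
    have h2 : Tendsto (fun n : ℕ ↦ 2 ^ n) atTop atTop :=
      tendsto_pow_atTop_atTop_of_one_lt one_lt_two
    obtain ⟨m, hm⟩ := (((tendsto_norm_pow_rpow (f v)).comp h2).eventually
      (gt_mem_nhds ((hM v hv).trans_lt hM'))).exists
    have hm' : ‖f v ^ 2 ^ m‖ < M' ^ 2 ^ m := by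
      have := (Real.rpow_inv_lt_iff_of_pos (norm_nonneg (f v ^ 2 ^ m)) hM'pos.le
        (by positivity : (0 : ℝ) < ((2 ^ m : ℕ) : ℝ))).mp (by simpa using hm)
      rwa [Real.rpow_natCast] at this
    have hc : Tendsto (fun n ↦ ‖f (u (φ n)) ^ 2 ^ m‖) atTop (𝓝 ‖f v ^ 2 ^ m‖) :=
      (((hcont v hv).tendsto.comp (tendsto_nhdsWithin_iff.mpr
        ⟨hlim, Eventually.of_forall fun n ↦ hu _⟩)).pow _).norm
    obtain ⟨n, hn, hnm⟩ := ((hc.eventually (gt_mem_nhds hm')).and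
      (hφ.tendsto_atTop.eventually_ge_atTop m)).exists
    obtain ⟨k, hk⟩ := Nat.exists_eq_add_of_le hnm
    have := hmono _ m k hn
    rw [← hk] at this
    exact absurd this (not_lt.mpr (hbad _))
  obtain ⟨n, hn⟩ := key
  refine le_of_norm_pow_le hM'pos.le (by positivity : 0 < 2 ^ n) ?_
  have hd : DiffContOnCl ℂ (fun w ↦ f w ^ 2 ^ n) U :=
    ⟨hf.differentiableOn.pow _, hf.continuousOn.pow _⟩
  exact norm_le_of_forall_mem_frontier_norm_le hU hd (fun z hz ↦ (hn z hz).le) hw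

open Metric in
/-- A bound on an annulus for a holomorphic family `f`, obtained from the maximum principle
applied to `w ↦ w⁻ʲ f(w)ᵏ`. -/
theorem pow_div_le_of_annulus {f : ℂ → A} (hf : Differentiable ℂ f) {r R M₁ M₂ : ℝ} (hr : 0 < r)
    {j k : ℕ} (hk : 0 < k) (h₁ : ∀ w : ℂ, ‖w‖ = r → spectralRadiusReal (f w) ≤ M₁)
    (h₂ : ∀ w : ℂ, ‖w‖ = R → spectralRadiusReal (f w) ≤ M₂) {w : ℂ} (hrw : r < ‖w‖)
    (hwR : ‖w‖ < R) :
    spectralRadiusReal (f w) ^ k / ‖w‖ ^ j ≤ max (M₁ ^ k / r ^ j) (M₂ ^ k / R ^ j) := by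
  have hval : ∀ u : ℂ, spectralRadiusReal ((u ^ j)⁻¹ • f u ^ k) =
      spectralRadiusReal (f u) ^ k / ‖u‖ ^ j := by
    intro u
    rw [smul, pow _ hk, norm_inv, norm_pow, div_eq_inv_mul]
  rw [← hval]
  have hcl : closure (ball (0 : ℂ) R \ closedBall 0 r) ⊆ closedBall 0 R \ ball 0 r :=
    closure_minimal (Set.sdiff_subset_sdiff ball_subset_closedBall ball_subset_closedBall)
      (isClosed_closedBall.sdiff isOpen_ball)
  have hopen : IsOpen (ball (0 : ℂ) R \ closedBall 0 r) := isOpen_ball.sdiff isClosed_closedBall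
  have hd : ∀ u ∈ closedBall (0 : ℂ) R \ ball 0 r,
      DifferentiableAt ℂ (fun u ↦ (u ^ j)⁻¹ • f u ^ k) u := by
    intro u hu
    have hu0 : u ≠ 0 := by
      rintro rfl
      exact hu.2 (mem_ball_self hr)
    exact (((differentiableAt_id).pow j).inv (pow_ne_zero _ hu0)).smul ((hf u).pow k)
  refine le_of_forall_mem_frontier_le (f := fun u ↦ (u ^ j)⁻¹ • f u ^ k)
    (U := ball 0 R \ closedBall 0 r) (isBounded_ball.subset Set.sdiff_subset)
    ⟨fun u hu ↦ (hd u (hcl (subset_closure hu))).differentiableWithinAt,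
      fun u hu ↦ (hd u (hcl hu)).continuousAt.continuousWithinAt⟩ ?_
    (subset_closure ⟨by simpa using hwR, by simpa using hrw⟩)
  intro u hu
  rw [hopen.frontier_eq] at hu
  obtain ⟨hu1, hu2⟩ := hu
  have hu3 := hcl hu1
  simp only [Set.mem_sdiff, mem_closedBall, dist_zero_right, mem_ball, not_lt, not_and,
    not_le] at hu2 hu3
  rw [hval]
  rcases hu3.1.lt_or_eq with h | h
  · have hur : ‖u‖ = r := le_antisymm (hu2 h) hu3.2
    refine le_max_of_le_left ?_
    rw [hur]
    have := h₁ u hur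
    have := nonneg (f u)
    gcongr
  · refine le_max_of_le_right ?_
    rw [h]
    have := h₂ u h
    have := nonneg (f u)
    have : 0 < R := hr.trans (hrw.trans hwR)
    gcongr

/-- If the spectral radius of an affine family vanishes near `0`, it vanishes everywhere. -/
theorem affine_eq_zero {a b : A} {r : ℝ} (hr : 0 < r)
    (h : ∀ w : ℂ, ‖w‖ ≤ r → spectralRadiusReal (a + w • b) = 0) (w : ℂ) :
    spectralRadiusReal (a + w • b) = 0 := by
  rcases le_or_gt ‖w‖ r with hw | hw
  · exact h w hw
  have hw0 : 0 < ‖w‖ := hr.trans hw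
  have hlim : Tendsto (fun R : ℝ ↦ (‖a‖ / R + ‖b‖) / R) atTop (𝓝 0) :=
    ((tendsto_const_nhds.div_atTop tendsto_id).add_const ‖b‖).div_atTop tendsto_id
  have hle : spectralRadiusReal (a + w • b) ^ 1 / ‖w‖ ^ 2 ≤ 0 := by
    refine ge_of_tendsto hlim ?_
    filter_upwards [eventually_gt_atTop ‖w‖] with R hR
    have hR0 : 0 < R := hw0.trans hR
    have := pow_div_le_of_annulus (f := fun w ↦ a + w • b) (by fun_prop) (r := r) (R := R)
      (M₁ := 0) (M₂ := ‖a‖ + R * ‖b‖) hr (j := 2) one_pos (fun u hu ↦ (h u hu.le).le)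
      (fun u hu ↦ (le_norm _).trans ((norm_add_le _ _).trans (by rw [norm_smul, hu]))) hw hR
    refine this.trans (max_le (by simp; positivity) (le_of_eq ?_))
    field_simp
  rw [pow_one, div_le_iff₀ (by positivity), zero_mul] at hle
  exact le_antisymm hle (nonneg _)

/-- A criterion for membership in the Jacobson radical in terms of the spectral radius. -/
theorem isUnit_one_add_mul {y : A} (h : ∀ b : A, spectralRadiusReal (b + y) ≤ ‖b‖) (c : A) :
    IsUnit (1 + c * y) := by
  have hsmul : ∀ (μ : ℂ) (b : A), spectralRadiusReal (b + μ • y) ≤ ‖b‖ := by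
    intro μ b
    rcases eq_or_ne μ 0 with rfl | hμ
    · simpa using le_norm b
    · have : b + μ • y = μ • (μ⁻¹ • b + y) := by rw [smul_add, smul_inv_smul₀ hμ]
      rw [this, smul]
      calc ‖μ‖ * spectralRadiusReal (μ⁻¹ • b + y) ≤ ‖μ‖ * ‖μ⁻¹ • b‖ := by gcongr; exact h _
        _ = ‖b‖ := by rw [← norm_smul, smul_inv_smul₀ hμ]
  have hunit : ∀ d : A, IsUnit d → ‖Ring.inverse d - 1‖ < 1 → spectralRadiusReal (d * y) = 0 := by
    intro d hd hd1
    refine eq_zero_of_isUnit fun μ ↦ ?_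
    have h1 : IsUnit (Ring.inverse d + μ • y) := by
      have := isUnit_one_add ((hsmul μ (Ring.inverse d - 1)).trans_lt hd1)
      convert this using 1
      abel
    have h2 : 1 + μ • (d * y) = d * (Ring.inverse d + μ • y) := by
      rw [mul_add, Ring.mul_inverse_cancel _ hd, mul_smul_comm]
    rw [h2]
    exact hd.mul h1
  have hev : ∀ᶠ d in 𝓝 (1 : A), spectralRadiusReal (d * y) = 0 := by
    have hc : ContinuousAt Ring.inverse (1 : A) := NormedRing.inverse_continuousAt (1 : Aˣ)
    have h1 : ∀ᶠ d in 𝓝 (1 : A), ‖Ring.inverse d - 1‖ < 1 := by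
      have := (hc.sub_const 1).norm
      simp only [Ring.inverse_one, sub_self, norm_zero] at this
      exact this.eventually (gt_mem_nhds one_pos)
    filter_upwards [h1, Units.nhds (1 : Aˣ)] with d hd hu
    exact hunit d hu hd
  have hcts : Tendsto (fun w : ℂ ↦ 1 + w • (c - 1)) (𝓝 0) (𝓝 1) := by
    have : Continuous fun w : ℂ ↦ 1 + w • (c - 1) := by fun_prop
    simpa using this.tendsto 0
  obtain ⟨r, hr, hball⟩ := Metric.eventually_nhds_iff_ball.mp (hcts.eventually hev)
  have hz := affine_eq_zero (a := y) (b := (c - 1) * y) (half_pos hr) (fun w hw ↦ by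
    have := hball w (by simpa using hw.trans_lt (half_lt_self hr))
    rwa [add_mul, one_mul, smul_mul_assoc] at this) 1
  rw [one_smul, sub_mul, one_mul, add_sub_cancel] at hz
  exact isUnit_one_add (hz.trans_lt one_pos)

theorem eq_zero_of_jacobson_eq_bot (hA : Ideal.jacobson (⊥ : Ideal A) = ⊥) {y : A}
    (h : ∀ b : A, spectralRadiusReal (b + y) ≤ ‖b‖) : y = 0 := by
  have hy : y ∈ Ideal.jacobson (⊥ : Ideal A) := by
    rw [Ideal.mem_jacobson_iff]
    intro c
    obtain ⟨u, hu⟩ := isUnit_one_add_mul h c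
    refine ⟨↑u⁻¹, ?_⟩
    have : (↑u⁻¹ : A) * (1 + c * y) = 1 := by rw [← hu, Units.inv_mul]
    rw [mul_add, mul_one, ← mul_assoc] at this
    rw [Ideal.mem_bot, sub_eq_zero, add_comm]
    exact this
  simpa [hA] using hy

theorem measurable_add_smul (b v : A) : Measurable fun ζ : ℂ ↦ spectralRadiusReal (b + ζ • v) :=
  measurable_of_tendsto_metrizable (fun n ↦ (continuous_norm_pow_rpow b v n).measurable)
    (tendsto_pi_nhds.2 fun ζ ↦ tendsto_norm_pow_rpow (b + ζ • v))

open MeasureTheory Metric in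
/-- The spectral radius is subharmonic on complex lines. -/
theorem volume_mul_le_setIntegral (b v : A) :
    volume.real (closedBall (0 : ℂ) 1) * spectralRadiusReal b ≤
      ∫ ζ in closedBall (0 : ℂ) 1, spectralRadiusReal (b + ζ • v) := by
  have : IsFiniteMeasure (volume.restrict (closedBall (0 : ℂ) 1)) :=
    isFiniteMeasure_restrict.2 measure_closedBall_lt_top.ne
  have hlim := (tendsto_add_atTop_iff_nat 1).2 (tendsto_norm_pow_rpow b)
  have h_integrable := tendsto_integral_of_dominated_convergence
    (μ := volume.restrict (closedBall (0 : ℂ) 1))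
    (F := fun (n : ℕ) (ζ : ℂ) ↦ ‖(b + ζ • v) ^ (n + 1)‖ ^ (1 / (n + 1 : ℕ) : ℝ))
    (f := fun ζ ↦ spectralRadiusReal (b + ζ • v)) (fun _ ↦ ‖b‖ + ‖v‖)
    (fun n ↦ (continuous_norm_pow_rpow b v (n + 1)).aestronglyMeasurable)
    (integrable_const _)
    (fun n ↦ by
      filter_upwards [ae_restrict_mem measurableSet_closedBall] with ζ hζ
      rw [mem_closedBall_zero_iff] at hζ
      rw [Real.norm_of_nonneg (by positivity)]
      refine (norm_pow_rpow_le _ n.succ_pos).trans ((norm_add_le _ _).trans ?_)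
      rw [norm_smul]
      gcongr
      exact mul_le_of_le_one_left (norm_nonneg _) hζ)
    (.of_forall fun ζ ↦ (tendsto_add_atTop_iff_nat 1).2 (tendsto_norm_pow_rpow (b + ζ • v)))
  refine le_of_tendsto_of_tendsto' (hlim.const_mul _) h_integrable fun n ↦ ?_
  have := _root_.volume_mul_le_setIntegral (continuous_norm_pow_rpow b v (n + 1)) fun ζ ↦ by
    simpa [mul_smul] using norm_pow_rpow_le_circleAverage b (ζ • v) n.succ_pos
  simpa using this

open MeasureTheory Metric in
/-- A two-constants estimate for the spectral radius on a complex line. -/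
theorem volume_mul_le_of_le_on {b v : A} {lam : ℂ} (hlam : ‖lam‖ ≤ 1) {E : Set ℂ} {M₁ M₂ η : ℝ}
    (hM₁ : 0 ≤ M₁) (hM₂ : 0 ≤ M₂) (hη : 0 ≤ η)
    (hE : ∀ ζ ∈ E, spectralRadiusReal (b + ζ • v) ≤ M₁)
    (hball : ∀ ζ : ℂ, ‖ζ‖ ≤ 2 → spectralRadiusReal (b + ζ • v) ≤ M₂)
    (hvol : volume (closedBall (0 : ℂ) 2) ≤
      volume (E ∩ closedBall (0 : ℂ) 2) + ENNReal.ofReal η) :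
    volume.real (closedBall (0 : ℂ) 1) * spectralRadiusReal (b + lam • v) ≤
      volume.real (closedBall (0 : ℂ) 1) * M₁ + η * M₂ := by
  have : IsFiniteMeasure (volume.restrict (closedBall (0 : ℂ) 1)) :=
    isFiniteMeasure_restrict.2 measure_closedBall_lt_top.ne
  set G : Set ℂ := {ζ | spectralRadiusReal (b + ζ • v) ≤ M₁}
  have hG : MeasurableSet G := measurableSet_le (measurable_add_smul b v) measurable_const
  set N : Set ℂ := closedBall 0 2 \ G
  have hN : MeasurableSet N := measurableSet_closedBall.diff hG
  have hNvol : volume N ≤ ENNReal.ofReal η := by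
    have h1 : volume (closedBall (0 : ℂ) 2 ∩ G) ≠ ⊤ :=
      ((measure_mono Set.inter_subset_left).trans_lt measure_closedBall_lt_top).ne
    rw [← ENNReal.add_le_add_iff_left h1, measure_inter_add_sdiff _ hG]
    exact hvol.trans (add_le_add (measure_mono fun ζ hζ ↦ ⟨hζ.2, hE ζ hζ.1⟩) le_rfl)
  set P : Set ℂ := (lam + ·) ⁻¹' N
  have hP : MeasurableSet P := measurable_const_add lam hN
  have hPvol : (volume.restrict (closedBall (0 : ℂ) 1)).real P ≤ η := by
    refine ENNReal.toReal_le_of_le_ofReal hη ((Measure.restrict_apply_le _ _).trans ?_)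
    rwa [measure_preimage_add]
  have hle : ∀ ζ ∈ closedBall (0 : ℂ) 1,
      spectralRadiusReal (b + lam • v + ζ • v) ≤ M₁ + P.indicator (fun _ ↦ M₂) ζ := by
    intro ζ hζ
    rw [mem_closedBall_zero_iff] at hζ
    have h2 : ‖lam + ζ‖ ≤ 2 := (norm_add_le _ _).trans (by linarith)
    rw [add_assoc, ← add_smul]
    by_cases h : ζ ∈ P
    · rw [Set.indicator_of_mem h]
      exact (hball _ h2).trans (le_add_of_nonneg_left hM₁)
    · rw [Set.indicator_of_notMem h, add_zero]
      by_contra h3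
      exact h ⟨mem_closedBall_zero_iff.2 h2, h3⟩
  have hi : IntegrableOn (P.indicator fun _ ↦ M₂) (closedBall (0 : ℂ) 1) :=
    (integrable_const M₂).indicator hP
  calc _ ≤ ∫ ζ in closedBall (0 : ℂ) 1, spectralRadiusReal (b + lam • v + ζ • v) :=
        volume_mul_le_setIntegral _ _
    _ ≤ ∫ ζ in closedBall (0 : ℂ) 1, (M₁ + P.indicator (fun _ ↦ M₂) ζ) := by
        refine integral_mono_of_nonneg (.of_forall fun ζ ↦ nonneg _)
          ((integrable_const M₁).add hi) ?_
        filter_upwards [ae_restrict_mem measurableSet_closedBall] with ζ hζ using hle ζ hζ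
    _ = volume.real (closedBall (0 : ℂ) 1) * M₁ +
          (volume.restrict (closedBall (0 : ℂ) 1)).real P * M₂ := by
        rw [integral_add (integrable_const M₁) hi, integral_indicator_const _ hP]
        simp
    _ ≤ _ := by gcongr

variable {B : Type*} [NormedRing B] [NormedAlgebra ℂ B] [CompleteSpace B] {T : A →+ B}

open MeasureTheory Metric in
theorem exists_map_add_smul_le (hsurj : Function.Surjective T)
    (hT : ∀ x, spectralRadiusReal (T x) = spectralRadiusReal x) (v : B) {ε : ℝ} (hε : 0 < ε) :
    ∃ m, ∀ (z : A) (lam : ℂ), ‖lam‖ ≤ 1 →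
      spectralRadiusReal (T z + lam • v) ≤ ‖z‖ + ε * ‖T z‖ + m := by
  obtain ⟨S, hS⟩ := hsurj.hasRightInverse
  set V := volume.real (closedBall (0 : ℂ) 1)
  have hV : 0 < V := ENNReal.toReal_pos (measure_closedBall_pos _ _ one_pos).ne'
    measure_closedBall_lt_top.ne
  let E : ℕ → Set ℂ := fun m ↦ {ζ | ‖S (ζ • v)‖ ≤ m}
  have hmono : Monotone E := fun i j hij ζ (hζ : ‖S (ζ • v)‖ ≤ i) ↦
    show ‖S (ζ • v)‖ ≤ j from hζ.trans (Nat.cast_le.2 hij)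
  have hunion : ⋃ m, E m = Set.univ :=
    Set.eq_univ_of_forall fun ζ ↦ Set.mem_iUnion.2 (exists_nat_ge ‖S (ζ • v)‖)
  have hlim := tendsto_measure_iUnion_atTop (μ := volume.restrict (closedBall (0 : ℂ) 2)) hmono
  rw [hunion, Measure.restrict_apply_univ] at hlim
  have hpos : volume (closedBall (0 : ℂ) 2) ≠ 0 := (measure_closedBall_pos _ _ two_pos).ne'
  have hlt : volume (closedBall (0 : ℂ) 2) - ENNReal.ofReal (ε * V) <
      volume (closedBall (0 : ℂ) 2) :=
    ENNReal.sub_lt_self measure_closedBall_lt_top.ne hpos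
      (ENNReal.ofReal_pos.2 (mul_pos hε hV)).ne'
  obtain ⟨m, hm⟩ := (hlim.eventually (lt_mem_nhds hlt)).exists
  rw [Function.comp_apply, Measure.restrict_apply' measurableSet_closedBall] at hm
  refine ⟨m + ε * (2 * ‖v‖), fun z lam hlam ↦ ?_⟩
  have := volume_mul_le_of_le_on (b := T z) (v := v) (E := E m) (M₁ := ‖z‖ + m)
    (M₂ := ‖T z‖ + 2 * ‖v‖) hlam (by positivity) (by positivity) (mul_pos hε hV).le
    (fun ζ hζ ↦ ?_) (fun ζ hζ ↦ ?_) (tsub_le_iff_right.1 hm.le)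
  · refine le_of_mul_le_mul_left (this.trans_eq ?_) hV
    ring
  · rw [← hS (ζ • v), ← map_add, hT]
    exact (le_norm _).trans ((norm_add_le _ _).trans (add_le_add_right hζ _))
  · refine (le_norm _).trans ((norm_add_le _ _).trans ?_)
    rw [norm_smul]
    gcongr

theorem map_ofReal_smul (hA : Ideal.jacobson (⊥ : Ideal A) = ⊥) (hsurj : Function.Surjective T)
    (hT : ∀ x, spectralRadiusReal (T x) = spectralRadiusReal x) (t : ℝ) (x : A) :
    T ((t : ℂ) • x) = (t : ℂ) • T x := by
  set y := T ((t : ℂ) • x) - (t : ℂ) • T x with hy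
  have hkey : ∀ z, spectralRadiusReal (T z + y) ≤ ‖z‖ := by
    intro z
    have hε : ∀ ε > 0, spectralRadiusReal (T z + y) ≤ ‖z‖ + ε * ‖T z + y‖ := by
      intro ε hε
      obtain ⟨m, hm⟩ := exists_map_add_smul_le hsurj hT (T x) hε
      have hN : ∀ N : ℕ, N * spectralRadiusReal (T z + y) ≤
          N * (‖z‖ + ε * ‖T z + y‖) + (‖x‖ + ε * ‖T x‖ + m) := by
        intro N
        set s : ℝ := Int.fract (N * t) with hs
        have hs1 : ‖(s : ℂ)‖ ≤ 1 := by
          rw [Complex.norm_real, Real.norm_of_nonneg (Int.fract_nonneg _)]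
          exact (Int.fract_lt_one _).le
        have hw : T ((N : ℂ) • z + (s : ℂ) • x) = (N : ℂ) • (T z + y) + (s : ℂ) • T x := by
          have h1 : (s : ℂ) • x = N • (t : ℂ) • x - ⌊N * t⌋ • x := by
            rw [← Nat.cast_smul_eq_nsmul ℂ, ← Int.cast_smul_eq_zsmul ℂ, smul_smul, ← sub_smul,
              hs, Int.fract]
            push_cast
            rfl
          have h2 : (s : ℂ) • T x = (N : ℂ) • (t : ℂ) • T x - ⌊N * t⌋ • T x := by
            rw [← Int.cast_smul_eq_zsmul ℂ, smul_smul, ← sub_smul, hs, Int.fract]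
            push_cast
            rfl
          rw [h1, h2, Nat.cast_smul_eq_nsmul, map_add, map_sub, map_nsmul, map_nsmul, map_zsmul, hy,
            smul_add, smul_sub]
          simp only [Nat.cast_smul_eq_nsmul]
          abel
        have h3 := hm ((N : ℂ) • z + (s : ℂ) • x) (-(s : ℂ)) (by rwa [norm_neg])
        have h4 : ‖(N : ℂ) • z + (s : ℂ) • x‖ ≤ N * ‖z‖ + ‖x‖ := by
          refine (norm_add_le _ _).trans ?_
          rw [norm_smul, norm_smul, Complex.norm_natCast]
          gcongr
          exact mul_le_of_le_one_left (norm_nonneg _) hs1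
        have h5 : ‖(N : ℂ) • (T z + y) + (s : ℂ) • T x‖ ≤ N * ‖T z + y‖ + ‖T x‖ := by
          refine (norm_add_le _ _).trans ?_
          rw [norm_smul, norm_smul, Complex.norm_natCast]
          gcongr
          exact mul_le_of_le_one_left (norm_nonneg _) hs1
        rw [hw, neg_smul, add_neg_cancel_right, smul, Complex.norm_natCast] at h3
        nlinarith
      by_contra! hlt
      obtain ⟨N, hN'⟩ := exists_nat_gt ((‖x‖ + ε * ‖T x‖ + m) /
        (spectralRadiusReal (T z + y) - (‖z‖ + ε * ‖T z + y‖)))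
      rw [div_lt_iff₀ (sub_pos.2 hlt)] at hN'
      linarith [hN N]
    refine le_of_forall_pos_le_add fun δ hδ ↦ ?_
    refine (hε (δ / (‖T z + y‖ + 1)) (by positivity)).trans ?_
    gcongr
    rw [div_mul_eq_mul_div, div_le_iff₀ (by positivity)]
    nlinarith
  obtain ⟨a, ha⟩ := hsurj y
  have ha0 : a = 0 := eq_zero_of_jacobson_eq_bot hA fun z ↦ by
    rw [← hT, map_add, ha]
    exact hkey z
  rw [ha0, map_zero] at ha
  exact sub_eq_zero.1 ha.symm

open Metric in
/-- A bound on a real segment controls the spectral radius of an affine map on a complex circle. -/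
theorem le_two_mul_of_forall_real {c d : A} {M R : ℝ} (hR : 0 < R)
    (h : ∀ s : ℝ, |s| ≤ 2 * R → spectralRadiusReal (c + (s : ℂ) • d) ≤ M) {lam : ℂ}
    (hlam : ‖lam‖ = R) : spectralRadiusReal (c + lam • d) ≤ 2 * M := by
  have hR0 : (R : ℂ) ≠ 0 := by exact_mod_cast hR.ne'
  set u : ℂ := lam / R with hu
  have hu1 : ‖u‖ = 1 := by
    rw [hu, norm_div, hlam, Complex.norm_real, Real.norm_of_nonneg hR.le, div_self hR.ne']
  obtain ⟨w, hw, hwle⟩ : ∃ w : ℂ, w * (u - w) = 1 ∧ ‖w‖ ≤ 1 := by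
    obtain ⟨s, hs⟩ := IsAlgClosed.exists_eq_mul_self (u ^ 2 - 4)
    have h1 : (u + s) / 2 * (u - (u + s) / 2) = 1 := by linear_combination (1 / 4) * hs
    by_cases hn : ‖(u + s) / 2‖ ≤ 1
    · exact ⟨_, h1, hn⟩
    · refine ⟨u - (u + s) / 2, by linear_combination h1, ?_⟩
      have h2 := congrArg norm h1
      rw [norm_mul, norm_one] at h2
      nlinarith [norm_nonneg (u - (u + s) / 2)]
  have hwge : 1 ≤ 2 * ‖w‖ := by
    have h1 : 1 = ‖w‖ * ‖u - w‖ := by rw [← norm_mul, hw, norm_one]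
    have h2 : ‖u - w‖ ≤ 2 := (norm_sub_le _ _).trans (by linarith)
    nlinarith [norm_nonneg w]
  let p : ℂ → A := fun z ↦ z • c + (R * (z ^ 2 + 1)) • d
  have hp : Differentiable ℂ p := by fun_prop
  have hpw : p w = w • (c + lam • d) := by
    have h1 : (R : ℂ) * (w ^ 2 + 1) = w * lam := by
      have h2 : lam = u * R := by rw [hu, div_mul_cancel₀ _ hR0]
      rw [h2]
      linear_combination -(R : ℂ) * hw
    simp only [p, h1, smul_add, smul_smul]
  have hfr : ∀ z ∈ frontier (ball (0 : ℂ) 1), spectralRadiusReal (p z) ≤ M := by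
    intro z hz
    rw [frontier_ball _ one_ne_zero, mem_sphere_zero_iff_norm] at hz
    have h1 : p z = z • (c + ((2 * R * z.re : ℝ) : ℂ) • d) := by
      have h2 : z ^ 2 + 1 = z * ((2 * z.re : ℝ) : ℂ) := by
        have h3 := Complex.mul_conj z
        rw [Complex.normSq_eq_norm_sq, hz] at h3
        rw [← Complex.add_conj]
        push_cast at h3
        linear_combination -h3
      simp only [p, h2, smul_add, smul_smul]
      push_cast
      ring_nf
    rw [h1, smul, hz, one_mul]
    refine h _ ?_
    have := z.abs_re_le_norm
    rw [abs_mul, abs_of_pos (by positivity)]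
    nlinarith
  have hle := le_of_forall_mem_frontier_le isBounded_ball hp.diffContOnCl hfr (w := w)
    (by rwa [closure_ball _ one_ne_zero, mem_closedBall_zero_iff])
  rw [hpw, smul] at hle
  nlinarith [nonneg (c + lam • d)]

theorem le_norm_of_forall_exists {b y : A} {M : ℝ} (h : ∀ R > 0, ∀ η > 0, ∃ c d : A,
      c + d = b + y ∧ ‖c - b‖ ≤ η ∧
      ∀ s : ℝ, |s| ≤ R → spectralRadiusReal (c + (s : ℂ) • d) ≤ M) :
    spectralRadiusReal (b + y) ≤ ‖b‖ := by
  have key : ∀ κ : ℝ, 0 < κ → κ < 1 → spectralRadiusReal (b + y) ≤ ‖b‖ + κ * (‖y‖ + 2) := by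
    intro κ hκ hκ1
    set N := ‖b‖ + κ * (‖y‖ + 2) with hN
    have hN0 : 0 < N := by positivity
    have hpow : ∀ k : ℕ, 0 < k → spectralRadiusReal (b + y) ^ k ≤ N ^ k / κ := by
      intro k hk
      obtain ⟨R, hR1, hR⟩ : ∃ R : ℝ, 1 < R ∧ (2 * M) ^ k / R ≤ N ^ k / κ := by
        have hlim : Tendsto (fun R : ℝ ↦ (2 * M) ^ k / R) atTop (𝓝 0) :=
          tendsto_const_nhds.div_atTop tendsto_id
        obtain ⟨R, h1, h2⟩ := ((eventually_gt_atTop 1).and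
          (hlim.eventually (ge_mem_nhds (show 0 < N ^ k / κ by positivity)))).exists
        exact ⟨R, h1, h2⟩
      obtain ⟨c, d, hcd, hc, hs⟩ := h (2 * R) (by linarith) κ hκ
      have hd : ‖d‖ ≤ ‖y‖ + κ := by
        have : d = y - (c - b) := by rw [eq_sub_of_add_eq' hcd]; abel
        rw [this]
        exact (norm_sub_le _ _).trans (by gcongr)
      have := pow_div_le_of_annulus (f := fun w ↦ c + w • d) (by fun_prop) (r := κ) (R := R)
        (M₁ := N) (M₂ := 2 * M) hκ (j := 1) hk (fun w hw ↦ ?_)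
        (fun w hw ↦ le_two_mul_of_forall_real (by linarith) hs hw) (w := 1)
        (by simpa using hκ1) (by simpa using hR1)
      · simp only [one_smul, hcd, norm_one, pow_one, div_one] at this
        exact this.trans (max_le le_rfl hR)
      · have hcb : ‖c‖ ≤ ‖b‖ + κ := by
          have : c = b + (c - b) := by abel
          rw [this]
          exact (norm_add_le _ _).trans (by gcongr)
        refine (le_norm _).trans ((norm_add_le _ _).trans ?_)
        rw [norm_smul, hw, hN]
        nlinarith
    by_contra! hlt
    obtain ⟨k, hk⟩ := pow_unbounded_of_one_lt (1 / κ) ((one_lt_div hN0).2 hlt)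
    have hk0 : 0 < k := by
      rcases Nat.eq_zero_or_pos k with rfl | h0
      · rw [pow_zero, one_div] at hk
        exact absurd ((one_lt_inv₀ hκ).2 hκ1) hk.not_gt
      · exact h0
    rw [div_pow, lt_div_iff₀ (by positivity), one_div_mul_eq_div] at hk
    exact hk.not_ge (hpow k hk0)
  have hlim : Tendsto (fun κ : ℝ ↦ ‖b‖ + κ * (‖y‖ + 2)) (𝓝[>] 0) (𝓝 ‖b‖) := by
    have : Continuous fun κ : ℝ ↦ ‖b‖ + κ * (‖y‖ + 2) := by fun_prop
    simpa using (this.tendsto 0).mono_left nhdsWithin_le_nhds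
  refine ge_of_tendsto hlim ?_
  filter_upwards [self_mem_nhdsWithin, nhdsWithin_le_nhds (gt_mem_nhds one_pos)] with κ h1 h2
    using key κ h1 h2

theorem eq_zero_of_tendsto_map_zero (hA : Ideal.jacobson (⊥ : Ideal A) = ⊥)
    (hT : ∀ x, spectralRadiusReal (T x) = spectralRadiusReal x)
    (hsmul : ∀ (t : ℝ) x, T ((t : ℂ) • x) = (t : ℂ) • T x) {x : ℕ → A} {a : A}
    (hx : Tendsto x atTop (𝓝 a)) (hTx : Tendsto (fun n ↦ T (x n)) atTop (𝓝 0)) : a = 0 := by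
  refine eq_zero_of_jacobson_eq_bot hA fun z ↦
    le_norm_of_forall_exists (M := ‖T (z + a)‖ + 1) fun R hR η hη ↦ ?_
  have h1 : ∀ᶠ n in atTop, ‖a - x n‖ < η := by
    have := (hx.const_sub a).norm
    rw [sub_self, norm_zero] at this
    exact this.eventually (gt_mem_nhds hη)
  have h2 : ∀ᶠ n in atTop, (1 + R) * ‖T (x n)‖ < 1 := by
    have := hTx.norm.const_mul (1 + R)
    rw [norm_zero, mul_zero] at this
    exact this.eventually (gt_mem_nhds one_pos)
  obtain ⟨n, hn1, hn2⟩ := (h1.and h2).exists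
  refine ⟨z + a - x n, x n, sub_add_cancel _ _, ?_, fun s hs ↦ ?_⟩
  · rw [show z + a - x n - z = a - x n by abel]
    exact hn1.le
  · rw [← hT, map_add, map_sub, hsmul]
    refine (le_norm _).trans ((norm_add_le _ _).trans ?_)
    have h3 := norm_sub_le (T (z + a)) (T (x n))
    rw [norm_smul, Complex.norm_real, Real.norm_eq_abs]
    nlinarith [norm_nonneg (T (x n))]

theorem exists_forall_mul_norm_le (hA : Ideal.jacobson (⊥ : Ideal A) = ⊥)
    (hsurj : Function.Surjective T)
    (hT : ∀ x, spectralRadiusReal (T x) = spectralRadiusReal x) :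
    ∃ α β : ℝ, 0 < α ∧ 0 < β ∧ ∀ x : A, α * ‖x‖ ≤ ‖T x‖ ∧ ‖T x‖ ≤ β * ‖x‖ := by
  have hsmul := map_ofReal_smul hA hsurj hT
  let L : A →ₗ[ℝ] B :=
    { toFun := T
      map_add' := map_add T
      map_smul' := fun t x ↦ hsmul t x }
  have hclosed : IsClosed (L.graph : Set (A × B)) := by
    refine IsSeqClosed.isClosed fun u p hu hp ↦ ?_
    obtain ⟨x', hx'⟩ := hsurj p.2
    have h1 : Tendsto (fun n ↦ (u n).1 - x') atTop (𝓝 (p.1 - x')) :=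
      ((continuous_fst.tendsto p).comp hp).sub_const x'
    have h2 : Tendsto (fun n ↦ T ((u n).1 - x')) atTop (𝓝 0) := by
      have h3 : Tendsto (fun n ↦ (u n).2 - p.2) atTop (𝓝 (p.2 - p.2)) :=
        ((continuous_snd.tendsto p).comp hp).sub_const p.2
      rw [sub_self] at h3
      refine h3.congr fun n ↦ ?_
      rw [map_sub, hx', show (u n).2 = T (u n).1 from (LinearMap.mem_graph_iff _ _).1 (hu n)]
    have h4 := eq_zero_of_tendsto_map_zero hA hT hsmul h1 h2
    refine (LinearMap.mem_graph_iff _ _).2 ?_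
    rw [sub_eq_zero.1 h4, ← hx']
    rfl
  have hker : (ContinuousLinearMap.ofIsClosedGraph hclosed).ker = ⊥ := by
    refine LinearMap.ker_eq_bot'.2 fun a ha ↦ ?_
    refine eq_zero_of_tendsto_map_zero hA hT hsmul (x := fun _ ↦ a) tendsto_const_nhds ?_
    rw [show T a = 0 from ha]
    exact tendsto_const_nhds
  let e := ContinuousLinearEquiv.ofBijective (ContinuousLinearMap.ofIsClosedGraph hclosed) hker
    (LinearMap.range_eq_top.2 hsurj)
  have he : ∀ x, e x = T x := fun x ↦ rfl
  refine ⟨(‖(e.symm : B →L[ℝ] A)‖ + 1)⁻¹, ‖(e : A →L[ℝ] B)‖ + 1, by positivity, by positivity,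
    fun x ↦ ⟨?_, ?_⟩⟩
  · rw [inv_mul_le_iff₀ (by positivity), ← he]
    calc ‖x‖ = ‖(e.symm : B →L[ℝ] A) (e x)‖ := by simp
      _ ≤ ‖(e.symm : B →L[ℝ] A)‖ * ‖e x‖ := ContinuousLinearMap.le_opNorm _ _
      _ ≤ _ := by gcongr; linarith
  · calc ‖T x‖ ≤ ‖(e : A →L[ℝ] B)‖ * ‖x‖ := (e : A →L[ℝ] B).le_opNorm x
      _ ≤ _ := by gcongr; linarith

end spectralRadiusReal

/-- A surjective additive spectrum preserving map from a semisimple complex unital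
Banach algebra is bounded above and below. -/
theorem bounded_above_and_below_of_additive_spectrum_preserving
    {A B : Type*} [NormedRing A] [NormedAlgebra ℂ A] [CompleteSpace A]
    [NormedRing B] [NormedAlgebra ℂ B] [CompleteSpace B]
    (hA : Ideal.jacobson (⊥ : Ideal A) = ⊥)
    (T : A → B)
    (hsurj : Function.Surjective T)
    (hadd : ∀ x y : A, T (x + y) = T x + T y)
    (hspec : ∀ x : A, spectrum ℂ (T x) = spectrum ℂ x) :
    ∃ α β : ℝ, 0 < α ∧ 0 < β ∧
      ∀ x : A, α * ‖x‖ ≤ ‖T x‖ ∧ ‖T x‖ ≤ β * ‖x‖ := by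
  exact spectralRadiusReal.exists_forall_mul_norm_le (T := AddMonoidHom.mk' T hadd) hA hsurj
    fun x ↦ le_antisymm (spectralRadiusReal.mono_of_spectrum_subset (hspec x).subset)
      (spectralRadiusReal.mono_of_spectrum_subset (hspec x).superset)
end

section
/- Let A and B be complex unital Banach algebras with A semisimple, and let T : A → B be a surjective additive map with σ(Tx) = σ(x) for all x ∈ A. Then T maps idempotents in A to idempotents in B: if e ∈ A satisfies e² = e, then (Te)² = Te. -/
open Filter Topology Polynomial

section Spectral

variable {B : Type*} [NormedRing B] [NormedAlgebra ℂ B] [CompleteSpace B]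

theorem eventually_norm_pow_le_of_spectrum {x : B} {M M' : ℝ} (hM : 0 ≤ M) (hMM' : M < M')
    (h : ∀ l ∈ spectrum ℂ x, ‖l‖ ≤ M) : ∀ᶠ k : ℕ in atTop, ‖x ^ k‖ ≤ M' ^ k := by
  have h1 : spectralRadius ℂ x ≤ ENNReal.ofReal M := by
    refine iSup₂_le fun l hl => ?_
    rw [← ENNReal.ofReal_coe_nnreal]
    exact ENNReal.ofReal_le_ofReal (by simpa using h l hl)
  have h2 : spectralRadius ℂ x < ENNReal.ofReal M' :=
    h1.trans_lt ((ENNReal.ofReal_lt_ofReal_iff (hM.trans_lt hMM')).2 hMM')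
  filter_upwards [(spectrum.pow_norm_pow_one_div_tendsto_nhds_spectralRadius x).eventually_lt_const h2,
    eventually_ge_atTop 1] with k hk hk1
  have hk2 := ((ENNReal.ofReal_lt_ofReal_iff (hM.trans_lt hMM')).1 hk).le
  have hk0 : (k : ℝ) ≠ 0 := by positivity
  calc ‖x ^ k‖ = (‖x ^ k‖ ^ (1 / k : ℝ)) ^ k := by
        rw [← Real.rpow_natCast, ← Real.rpow_mul (norm_nonneg _), one_div, inv_mul_cancel₀ hk0,
          Real.rpow_one]
    _ ≤ M' ^ k := by gcongr

theorem norm_pow_le_of_mem_spectrum {x : B} {l : ℂ} (hl : l ∈ spectrum ℂ x) (k : ℕ) :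
    ‖l‖ ^ k ≤ ‖x ^ k‖ * ‖(1 : B)‖ := by
  rw [← norm_pow]
  exact spectrum.norm_le_norm_mul_of_mem (spectrum.pow_mem_pow x k hl)

theorem norm_le_of_frequently_pow_le {r C L : ℝ} (hL : 0 ≤ L)
    (h : ∃ᶠ k : ℕ in atTop, r ^ k ≤ C * L ^ k) : r ≤ L := by
  by_contra! hlt
  have hr0 : 0 < r := hL.trans_lt hlt
  have h1 : Tendsto (fun k : ℕ => C * (L / r) ^ k) atTop (𝓝 (C * 0)) :=
    (tendsto_pow_atTop_nhds_zero_of_lt_one (by positivity) ((div_lt_one hr0).2 hlt)).const_mul C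
  rw [mul_zero] at h1
  obtain ⟨k, hk1, hk2⟩ := (h.and_eventually (h1.eventually_lt_const one_pos)).exists
  rw [div_pow, ← mul_div_assoc, div_lt_one (by positivity)] at hk2
  linarith

theorem norm_le_of_mem_spectrum_of_frequently {x : B} {C L : ℝ} (hL : 0 ≤ L)
    (h : ∃ᶠ k : ℕ in atTop, ‖x ^ k‖ ≤ C * L ^ k) {l : ℂ} (hl : l ∈ spectrum ℂ x) : ‖l‖ ≤ L := by
  refine norm_le_of_frequently_pow_le (C := C * ‖(1 : B)‖) hL (h.mono fun k hk => ?_)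
  calc ‖l‖ ^ k ≤ ‖x ^ k‖ * ‖(1 : B)‖ := norm_pow_le_of_mem_spectrum hl k
    _ ≤ C * L ^ k * ‖(1 : B)‖ := by gcongr
    _ = _ := by ring

/-- Commuting products with a quasinilpotent element are quasinilpotent. -/
theorem spectrum_mul_eq_zero_of_commute {a m : B} (ham : Commute a m)
    (ha : ∀ l ∈ spectrum ℂ a, l = 0) : ∀ l ∈ spectrum ℂ (a * m), l = 0 := by
  intro l hl
  have key : ∀ ε : ℝ, 0 < ε → ‖l‖ ≤ ε * (‖m‖ + 1) := by
    intro ε hε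
    have h1 := eventually_norm_pow_le_of_spectrum (x := a) le_rfl hε (fun l hl => by simp [ha l hl])
    refine norm_le_of_mem_spectrum_of_frequently (x := a * m) (C := 1) (by positivity)
      (Eventually.frequently ?_) hl
    filter_upwards [h1, eventually_ge_atTop 1] with k hk hk1
    rw [ham.mul_pow, one_mul, mul_pow]
    calc ‖a ^ k * m ^ k‖ ≤ ‖a ^ k‖ * ‖m ^ k‖ := norm_mul_le _ _
      _ ≤ ε ^ k * (‖m‖ + 1) ^ k := by
        gcongr
        exact (norm_pow_le' m hk1).trans (by gcongr; linarith)
  rw [← norm_le_zero_iff]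
  refine le_of_forall_pos_le_add fun ε hε => ?_
  have := key (ε / (‖m‖ + 1)) (by positivity)
  rw [div_mul_cancel₀ _ (by positivity)] at this
  linarith

end Spectral

section Remez

theorem exists_separated_finset {S : Set ℝ} (n : ℕ) {d : ℝ} (hd : 0 ≤ d)
    (hS : ENNReal.ofReal (2 * d * n) < MeasureTheory.volume S) :
    ∀ m ≤ n + 1, ∃ s : Finset ℝ, s.card = m ∧ (↑s ⊆ S) ∧
      ∀ a ∈ s, ∀ b ∈ s, a ≠ b → d ≤ |a - b| := by
  intro m
  induction m with
  | zero => exact fun _ => ⟨∅, by simp⟩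
  | succ m ih =>
    intro hm
    obtain ⟨s, hc, hsS, hs⟩ := ih (by omega)
    obtain ⟨t, htS, ht⟩ : ∃ t ∈ S, t ∉ ⋃ a ∈ s, Metric.ball a d ∪ {a} := by
      by_contra! hcon
      have h1 : MeasureTheory.volume S ≤ ENNReal.ofReal (2 * d * n) := by
        calc MeasureTheory.volume S ≤ MeasureTheory.volume (⋃ a ∈ s, (Metric.ball a d ∪ {a})) :=
              MeasureTheory.measure_mono hcon
          _ ≤ ∑ a ∈ s, MeasureTheory.volume (Metric.ball a d ∪ {a}) :=
              MeasureTheory.measure_biUnion_finset_le _ _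
          _ ≤ ∑ a ∈ s, ENNReal.ofReal (2 * d) := by
              refine Finset.sum_le_sum fun a _ => ?_
              refine (MeasureTheory.measure_union_le _ _).trans ?_
              simp
          _ = ENNReal.ofReal (2 * d * m) := by
              rw [Finset.sum_const, hc, nsmul_eq_mul, mul_comm, ENNReal.ofReal_mul (p := 2 * d) (by positivity),
                ENNReal.ofReal_natCast]
          _ ≤ _ := by
              apply ENNReal.ofReal_le_ofReal
              gcongr
              omega
      exact absurd hS h1.not_gt
    simp only [Set.mem_iUnion, not_exists, Set.mem_union, Metric.mem_ball, Real.dist_eq,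
      Set.mem_singleton_iff, not_or, not_lt] at ht
    have hts : t ∉ s := fun h => (ht t h).2 rfl
    refine ⟨insert t s, by rw [Finset.card_insert_of_notMem hts, hc], ?_, ?_⟩
    · rw [Finset.coe_insert]
      exact Set.insert_subset htS hsS
    · intro a ha b hb hab
      rw [Finset.mem_insert] at ha hb
      rcases ha with rfl | ha <;> rcases hb with rfl | hb
      · exact absurd rfl hab
      · exact (ht b hb).1
      · rw [abs_sub_comm]; exact (ht a ha).1
      · exact hs a ha b hb hab

theorem exists_separated_sequence {S : Set ℝ} (n : ℕ) {d : ℝ} (hd : 0 ≤ d)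
    (hS : ENNReal.ofReal (2 * d * n) < MeasureTheory.volume S) :
    ∃ v : Fin (n + 1) → ℝ, (∀ i, v i ∈ S) ∧ Function.Injective v ∧
      ∀ i j : Fin (n + 1), d * |(i : ℝ) - j| ≤ |v i - v j| := by
  obtain ⟨s, hc, hsS, hs⟩ := exists_separated_finset n hd hS (n + 1) le_rfl
  let v := s.orderEmbOfFin hc
  have hv : ∀ i, v i ∈ s := fun i => s.orderEmbOfFin_mem hc i
  have key : ∀ (m i : ℕ) (h : i + m < n + 1), d * m ≤ v ⟨i + m, h⟩ - v ⟨i, by omega⟩ := by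
    intro m
    induction m with
    | zero => intro i h; simp
    | succ m ih =>
      intro i h
      have h1 := ih i (by omega)
      have hlt : v ⟨i + m, by omega⟩ < v ⟨i + (m + 1), h⟩ :=
        v.strictMono (by simp [Fin.lt_def])
      have h2 := hs _ (hv ⟨i + (m + 1), h⟩) _ (hv ⟨i + m, by omega⟩) hlt.ne'
      rw [abs_of_pos (by linarith)] at h2
      push_cast
      linarith
  have key' : ∀ i j : Fin (n + 1), i ≤ j → d * |(i : ℝ) - j| ≤ |v i - v j| := by
    intro i j hij
    have hij' : (i : ℕ) ≤ j := hij
    have h1 := key (j - i) i (by omega)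
    have h2 : (⟨i + (j - i), by omega⟩ : Fin (n + 1)) = j := by ext; simp; omega
    rw [h2, Nat.cast_sub hij'] at h1
    have h3 : (i : ℝ) ≤ j := by exact_mod_cast hij'
    rw [abs_sub_comm, abs_of_nonneg (by linarith), abs_sub_comm]
    exact h1.trans (le_abs_self _)
  refine ⟨v, fun i => hsS (hv i), v.injective, fun i j => ?_⟩
  rcases le_total i j with h | h
  · exact key' i j h
  · rw [abs_sub_comm, abs_sub_comm (v i)]
    exact key' j i h

theorem prod_erase_abs_sub (n : ℕ) (i : Fin (n + 1)) :
    ∏ j ∈ Finset.univ.erase i, |(i : ℝ) - j| = (i : ℕ).factorial * (n - i).factorial := by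
  have h1 : ∏ j ∈ Finset.univ.erase i, |(i : ℝ) - j| =
      ∏ j ∈ (Finset.range (n + 1)).erase i, |((i : ℕ) : ℝ) - j| := by
    refine Finset.prod_bij (fun j _ => (j : ℕ)) ?_ ?_ ?_ ?_
    · intro a ha
      simp only [Finset.mem_erase, Finset.mem_univ, and_true, Finset.mem_range] at ha ⊢
      exact ⟨fun h => ha (Fin.ext h), a.2⟩
    · intro a _ b _ h; exact Fin.ext h
    · intro b hb
      simp only [Finset.mem_erase, Finset.mem_range] at hb
      exact ⟨⟨b, hb.2⟩, by simp [Fin.ext_iff, hb.1], rfl⟩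
    · intros; rfl
  obtain ⟨i, hi⟩ := i
  obtain ⟨m, rfl⟩ : ∃ m, n = i + m := ⟨n - i, by omega⟩
  rw [h1]
  simp only
  have h2 : (Finset.range (i + m + 1)).erase i =
      (Finset.range i).disjUnion ((Finset.range m).map (addLeftEmbedding (i + 1))) (by
        rw [Finset.disjoint_left]; intro a; simp; omega) := by
    ext a
    simp only [Finset.mem_erase, Finset.mem_range, Finset.mem_disjUnion, Finset.mem_map,
      addLeftEmbedding_apply]
    constructor
    · intro h
      rcases lt_or_ge a i with h' | h'
      · exact Or.inl h'
      · exact Or.inr ⟨a - (i + 1), by omega, by omega⟩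
    · rintro (h | ⟨b, hb, rfl⟩) <;> omega
  rw [h2, Finset.prod_disjUnion, Finset.prod_map, Nat.add_sub_cancel_left]
  congr 1
  · rw [← Finset.prod_range_reflect, ← Finset.prod_range_add_one_eq_factorial]
    push_cast
    refine Finset.prod_congr rfl fun j hj => ?_
    rw [Finset.mem_range] at hj
    rw [Nat.sub_sub, Nat.cast_sub (by omega)]
    push_cast
    rw [abs_of_nonneg (by linarith [(Nat.cast_nonneg j : (0:ℝ) ≤ j)])]
    ring
  · rw [← Finset.prod_range_add_one_eq_factorial]
    push_cast
    refine Finset.prod_congr rfl fun j hj => ?_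
    simp only [addLeftEmbedding_apply]
    push_cast
    rw [abs_sub_comm, abs_of_nonneg (by linarith [(Nat.cast_nonneg j : (0:ℝ) ≤ j)])]
    ring

theorem norm_eval_basis_le (k : ℕ) {d : ℝ} (hd : 0 < d) (v : Fin (k + 1) → ℝ)
    (hv01 : ∀ i, v i ∈ Set.Icc (0 : ℝ) 1)
    (hv : ∀ i j : Fin (k + 1), d * |(i : ℝ) - j| ≤ |v i - v j|) (z : ℂ) (i : Fin (k + 1)) :
    ‖(Lagrange.basis Finset.univ (fun i => (v i : ℂ)) i).eval z‖ ≤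
      ((‖z‖ + 1) / d) ^ k / k.factorial * (k.choose i : ℝ) := by
  have hcard : (Finset.univ.erase i).card = k := by simp
  have h1 : ‖(Lagrange.basis Finset.univ (fun i => (v i : ℂ)) i).eval z‖ =
      ∏ j ∈ Finset.univ.erase i, (‖z - v j‖ / |v i - v j|) := by
    rw [Lagrange.basis, eval_prod, norm_prod]
    refine Finset.prod_congr rfl fun j _ => ?_
    rw [Lagrange.basisDivisor, eval_mul, eval_C, eval_sub, eval_X, eval_C, norm_mul, norm_inv,
      ← Complex.ofReal_sub, Complex.norm_real, Real.norm_eq_abs, div_eq_inv_mul]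
  have h2 : ∀ j ∈ Finset.univ.erase i,
      ‖z - v j‖ / |v i - v j| ≤ (‖z‖ + 1) / d * |(i : ℝ) - j|⁻¹ := by
    intro j hj
    have hij : (i : ℝ) - j ≠ 0 := by
      rw [sub_ne_zero]
      intro h
      exact (Finset.ne_of_mem_erase hj) (Fin.ext (by exact_mod_cast h.symm))
    have h3 : ‖z - v j‖ ≤ ‖z‖ + 1 := by
      refine (norm_sub_le _ _).trans ?_
      rw [Complex.norm_real, Real.norm_eq_abs, abs_of_nonneg (hv01 j).1]
      linarith [(hv01 j).2]
    calc ‖z - v j‖ / |v i - v j| ≤ (‖z‖ + 1) / (d * |(i : ℝ) - j|) := by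
          gcongr
          exact hv i j
      _ = _ := by rw [div_mul_eq_div_div, div_eq_mul_inv _ |(i : ℝ) - j|]
  have hi : (i : ℕ) ≤ k := by omega
  rw [h1]
  refine (Finset.prod_le_prod (fun _ _ => by positivity) h2).trans (le_of_eq ?_)
  rw [Finset.prod_mul_distrib, Finset.prod_const, hcard, Finset.prod_inv_distrib,
    prod_erase_abs_sub, Nat.cast_choose ℝ hi]
  have : (k.factorial : ℝ) ≠ 0 := by positivity
  field_simp

theorem four_mul_succ_pow_div_factorial_le (k : ℕ) :
    (4 * ((k : ℝ) + 1)) ^ k / k.factorial * 2 ^ k ≤ 3 * 24 ^ k := by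
  have h1 : ((k : ℝ) + 1) ^ k / k.factorial ≤ 3 ^ (k + 1) := by
    calc ((k : ℝ) + 1) ^ k / k.factorial = ((k : ℝ) + 1) ^ (k + 1) / (k + 1).factorial := by
          rw [Nat.factorial_succ]
          push_cast
          rw [pow_succ', mul_div_mul_left _ _ (by positivity)]
      _ ≤ Real.exp (k + 1) := Real.pow_div_factorial_le_exp _ (by positivity) _
      _ = Real.exp 1 ^ (k + 1) := by rw [← Real.exp_nat_mul]; push_cast; ring_nf
      _ ≤ 3 ^ (k + 1) := by
          gcongr
          exact Real.exp_one_lt_d9.le.trans (by norm_num)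
  calc (4 * ((k : ℝ) + 1)) ^ k / k.factorial * 2 ^ k
      = ((k : ℝ) + 1) ^ k / k.factorial * 8 ^ k := by
        rw [mul_pow, show (8 : ℝ) = 4 * 2 by norm_num, mul_pow 4 2]
        ring
    _ ≤ 3 ^ (k + 1) * 8 ^ k := by gcongr
    _ = 3 * 24 ^ k := by
        rw [show (24 : ℝ) = 3 * 8 by norm_num, mul_pow]
        ring

/-- A Remez type inequality: a polynomial that is bounded on a subset of the unit interval of outer
measure more than one half is bounded, with exponential dependence on the degree, everywhere. -/
theorem norm_sum_pow_smul_le {E : Type*} [NormedAddCommGroup E] [NormedSpace ℂ E] (c : ℕ → E)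
    (k : ℕ) {S : Set ℝ} (hS01 : S ⊆ Set.Icc 0 1)
    (hS : ENNReal.ofReal (1 / 2) < MeasureTheory.volume S) {K : ℝ}
    (hK : ∀ t ∈ S, ‖∑ j ∈ Finset.range (k + 1), (t : ℂ) ^ j • c j‖ ≤ K) (z : ℂ) :
    ‖∑ j ∈ Finset.range (k + 1), z ^ j • c j‖ ≤ 3 * (24 * (‖z‖ + 1)) ^ k * K := by
  have hk1 : (0 : ℝ) < 4 * ((k : ℝ) + 1) := by positivity
  obtain ⟨v, hvS, hinj, hv⟩ := exists_separated_sequence (S := S) k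
    (d := 1 / (4 * ((k : ℝ) + 1))) (by positivity) (lt_of_le_of_lt (ENNReal.ofReal_le_ofReal (by
      rw [mul_one_div, div_mul_eq_mul_div, div_le_div_iff₀ hk1 two_pos]
      linarith)) hS)
  have hK0 : 0 ≤ K := (norm_nonneg _).trans (hK _ (hvS 0))
  let w : Fin (k + 1) → ℂ := fun i => (v i : ℂ)
  let ℓ : Fin (k + 1) → ℂ := fun i => (Lagrange.basis Finset.univ w i).eval z
  have hw : Set.InjOn w (Finset.univ : Finset (Fin (k + 1))) := by
    intro i _ j _ h
    exact hinj (Complex.ofReal_injective h)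
  have hℓ : ∀ j ∈ Finset.range (k + 1), z ^ j = ∑ i, ℓ i * w i ^ j := by
    intro j hj
    have h := Lagrange.eq_interpolate (f := (X ^ j : ℂ[X])) hw (by
      rw [degree_X_pow, Finset.card_univ, Fintype.card_fin]
      exact_mod_cast Finset.mem_range.1 hj)
    have h2 := congrArg (eval z) h
    rw [Lagrange.interpolate_apply, eval_finsetSum] at h2
    simp only [eval_pow, eval_X, eval_mul, eval_C] at h2
    rw [h2]
    exact Finset.sum_congr rfl fun i _ => mul_comm _ _
  have hsum : ∑ j ∈ Finset.range (k + 1), z ^ j • c j =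
      ∑ i, ℓ i • ∑ j ∈ Finset.range (k + 1), w i ^ j • c j := by
    simp_rw [Finset.smul_sum]
    rw [Finset.sum_comm]
    refine Finset.sum_congr rfl fun j hj => ?_
    rw [hℓ j hj, Finset.sum_smul]
    exact Finset.sum_congr rfl fun i _ => by rw [mul_smul]
  rw [hsum]
  calc ‖∑ i, ℓ i • ∑ j ∈ Finset.range (k + 1), w i ^ j • c j‖
      ≤ ∑ i : Fin (k + 1), ((‖z‖ + 1) / (1 / (4 * ((k : ℝ) + 1)))) ^ k / k.factorial *
          (k.choose i : ℝ) * K := by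
        refine (norm_sum_le _ _).trans (Finset.sum_le_sum fun i _ => ?_)
        rw [norm_smul]
        gcongr
        · exact norm_eval_basis_le k (by positivity) v (fun i => hS01 (hvS i)) hv z i
        · exact hK _ (hvS i)
    _ = (‖z‖ + 1) ^ k * ((4 * ((k : ℝ) + 1)) ^ k / k.factorial * 2 ^ k) * K := by
        rw [← Finset.sum_mul, ← Finset.mul_sum,
          Fin.sum_univ_eq_sum_range (fun i => (k.choose i : ℝ)) (k + 1)]
        have : ∑ i ∈ Finset.range (k + 1), (k.choose i : ℝ) = 2 ^ k := by
          exact_mod_cast Nat.sum_range_choose k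
        rw [this, one_div, div_inv_eq_mul, mul_pow]
        ring
    _ ≤ (‖z‖ + 1) ^ k * (3 * 24 ^ k) * K :=
        mul_le_mul_of_nonneg_right (mul_le_mul_of_nonneg_left
          (four_mul_succ_pow_div_factorial_le k) (by positivity)) hK0
    _ = _ := by rw [mul_pow]; ring

end Remez

section Pencil

variable {B : Type*} [NormedRing B] [NormedAlgebra ℂ B]

theorem exists_coeff_add_smul_pow (x y : B) (k : ℕ) :
    ∃ c : ℕ → B, ∀ z : ℂ, (x + z • y) ^ k = ∑ j ∈ Finset.range (k + 1), z ^ j • c j := by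
  induction k with
  | zero => exact ⟨fun _ => 1, by simp⟩
  | succ k ih =>
    obtain ⟨c, hc⟩ := ih
    refine ⟨fun j => (if j ≤ k then c j * x else 0) + (if j = 0 then 0 else c (j - 1) * y),
      fun z => ?_⟩
    simp only [smul_add]
    rw [pow_succ, hc, Finset.sum_add_distrib, mul_add]
    congr 1
    · rw [Finset.sum_range_succ _ (k + 1), Finset.sum_mul]
      simp only [add_le_iff_nonpos_right, nonpos_iff_eq_zero, one_ne_zero, if_false, smul_zero,
        add_zero]
      refine Finset.sum_congr rfl fun j hj => ?_
      rw [if_pos (by simpa [Nat.lt_succ_iff] using hj), smul_mul_assoc]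
    · rw [Finset.sum_range_succ' _ (k + 1), Finset.sum_mul]
      simp only [pow_succ, mul_smul, mul_smul_comm, smul_mul_assoc, Nat.add_eq_zero_iff,
        one_ne_zero, and_false, if_false, if_true, smul_zero, add_zero, add_tsub_cancel_right]
      exact Finset.sum_congr rfl fun j _ => smul_comm _ _ _

variable [CompleteSpace B]

/-- A spectral bound for `x + t • y` on a large set of real parameters `t` gives a bound for the
powers of `x + z • y`, locally uniformly in the complex parameter `z`. -/
theorem eventually_norm_add_smul_pow_le {x y : B} {S : Set ℝ} (hS01 : S ⊆ Set.Icc 0 1)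
    (hS : ENNReal.ofReal (1 / 2) < MeasureTheory.volume S) {M M' : ℝ} (hM : 0 ≤ M) (hMM' : M < M')
    (h : ∀ t ∈ S, ∀ l ∈ spectrum ℂ (x + (t : ℂ) • y), ‖l‖ ≤ M) :
    ∀ᶠ k : ℕ in atTop, ∀ z : ℂ, ‖(x + z • y) ^ k‖ ≤ 3 * (24 * (‖z‖ + 1) * M') ^ k := by
  let F : ℕ → Set ℝ := fun K => {t ∈ S | ∀ k ≥ K, ‖(x + (t : ℂ) • y) ^ k‖ ≤ M' ^ k}
  have hF : ⋃ K, F K = S := by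
    refine Set.Subset.antisymm (Set.iUnion_subset fun K t ht => ht.1) fun t ht => ?_
    obtain ⟨K, hK⟩ := eventually_atTop.1 (eventually_norm_pow_le_of_spectrum hM hMM' (h t ht))
    exact Set.mem_iUnion.2 ⟨K, ht, hK⟩
  have hmono : Monotone F := fun K K' hKK' t ht => ⟨ht.1, fun k hk => ht.2 k (hKK'.trans hk)⟩
  have htend := MeasureTheory.tendsto_measure_iUnion_atTop (μ := MeasureTheory.volume) hmono
  rw [hF] at htend
  obtain ⟨K, hK⟩ := (htend.eventually_const_lt hS).exists
  filter_upwards [eventually_ge_atTop K] with k hk z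
  obtain ⟨c, hc⟩ := exists_coeff_add_smul_pow x y k
  rw [hc, mul_pow, ← mul_assoc]
  refine norm_sum_pow_smul_le c k (fun t ht => hS01 ht.1) hK (fun t ht => ?_) z
  rw [← hc]
  exact ht.2 k hk

theorem norm_le_of_mem_spectrum_add_ofReal_smul {q y : B} {L : ℝ} (hL : 0 < L)
    (h : ∀ᶠ n : ℕ in atTop, ∀ᶠ k : ℕ in atTop, ∀ z : ℂ, ‖z‖ = 1 →
      ‖((n : ℂ) • q + z • y) ^ k‖ ≤ 3 * L ^ k) {W : ℝ} (hW : 1 ≤ W) {l : ℂ}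
    (hl : l ∈ spectrum ℂ (y + (W : ℂ) • q)) : ‖l‖ ≤ ‖y‖ + ‖q‖ + 1 := by
  set a : ℝ := ‖y‖ + ‖q‖ + 1 with ha
  have ha0 : 0 < a := by positivity
  let t : ℕ → ℝ := fun n => Real.log W / Real.log n
  have ht : Tendsto t atTop (𝓝 0) :=
    (Real.tendsto_log_atTop.comp tendsto_natCast_atTop_atTop).const_div_atTop _
  have hlim : Tendsto (fun n => a ^ (1 - t n) * L ^ t n) atTop (𝓝 (a ^ (1 - 0 : ℝ) * L ^ (0 : ℝ))) :=
    (tendsto_const_nhds.rpow (ht.const_sub 1) (Or.inl ha0.ne')).mul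
      (tendsto_const_nhds.rpow ht (Or.inl hL.ne'))
  rw [sub_zero, Real.rpow_one, Real.rpow_zero, mul_one] at hlim
  refine ge_of_tendsto hlim ?_
  filter_upwards [h, eventually_ge_atTop 2,
    tendsto_natCast_atTop_atTop.eventually (eventually_ge_atTop W)] with n hn hn2 hnW
  have hn0 : (0 : ℝ) < n := by positivity
  have hlogn : 0 < Real.log n := Real.log_pos (by exact_mod_cast hn2)
  have hlogW : 0 ≤ Real.log W := Real.log_nonneg hW
  have hlogWn : Real.log W ≤ Real.log n := Real.log_le_log (by linarith) hnW
  refine norm_le_of_frequently_pow_le (C := 3 ^ t n * ‖(1 : B)‖) (by positivity)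
    (Eventually.frequently ?_)
  filter_upwards [hn, eventually_ge_atTop 1] with k hk hk1
  let f : ℂ → B := fun z => (y + Complex.exp z • q) ^ k
  have hnorm : ∀ R : ℝ, 0 ≤ R → ∀ z : ℂ, ‖Complex.exp z‖ ≤ R → ‖f z‖ ≤ (‖y‖ + R * ‖q‖) ^ k := by
    intro R hR z hz
    refine (norm_pow_le' _ hk1).trans ?_
    gcongr
    refine (norm_add_le _ _).trans ?_
    rw [norm_smul]
    gcongr
  have hf : ‖f (Real.log W)‖ ≤ (a ^ k) ^ (1 - t n) * (3 * L ^ k) ^ t n := by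
    have := Complex.HadamardThreeLines.norm_le_interp_of_mem_verticalClosedStrip' (f := f)
      (z := (Real.log W : ℂ)) (a := a ^ k) (b := 3 * L ^ k) (l := 0) (u := Real.log n) hlogn
      ⟨by simpa using hlogW, by simpa using hlogWn⟩ ?_ ?_ ?_ ?_
    · simpa [t] using this
    · apply Differentiable.diffContOnCl
      fun_prop
    · refine ⟨(‖y‖ + n * ‖q‖) ^ k, ?_⟩
      rintro _ ⟨z, hz, rfl⟩
      refine hnorm n hn0.le z ?_
      rw [Complex.norm_exp, ← Real.le_log_iff_exp_le hn0]
      exact hz.2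
    · intro z hz
      refine (hnorm 1 zero_le_one z ?_).trans ?_
      · rw [Complex.norm_exp, show z.re = 0 from hz, Real.exp_zero]
      · gcongr
        linarith
    · intro z hz
      have hz' : z.re = Real.log n := hz
      have he : ‖Complex.exp z‖ = n := by rw [Complex.norm_exp, hz', Real.exp_log hn0]
      have hn0' : (n : ℂ) ≠ 0 := by exact_mod_cast hn0.ne'
      have hez := Complex.exp_ne_zero z
      set u : ℂ := Complex.exp z / n with hu
      have hu1 : ‖u‖ = 1 := by rw [hu, norm_div, he, Complex.norm_natCast, div_self hn0.ne']
      have hu0 : u ≠ 0 := by rw [← norm_pos_iff, hu1]; exact one_pos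
      have hfz : f z = u ^ k • ((n : ℂ) • q + u⁻¹ • y) ^ k := by
        rw [← _root_.smul_pow, smul_add, smul_smul, smul_smul, mul_inv_cancel₀ hu0, one_smul, hu,
          div_mul_cancel₀ _ hn0', add_comm]
      rw [hfz, norm_smul, norm_pow, hu1, one_pow, one_mul]
      exact hk _ (by rw [norm_inv, hu1, inv_one])
  have hfW : f (Real.log W) = (y + (W : ℂ) • q) ^ k := by
    simp only [f]
    rw [← Complex.ofReal_exp, Real.exp_log (by linarith)]
  rw [hfW] at hf
  calc ‖l‖ ^ k ≤ ‖(y + (W : ℂ) • q) ^ k‖ * ‖(1 : B)‖ := norm_pow_le_of_mem_spectrum hl k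
    _ ≤ (a ^ k) ^ (1 - t n) * (3 * L ^ k) ^ t n * ‖(1 : B)‖ := by gcongr
    _ = 3 ^ t n * ‖(1 : B)‖ * (a ^ (1 - t n) * L ^ t n) ^ k := by
        rw [Real.mul_rpow (by norm_num) (by positivity), mul_pow, ← Real.rpow_natCast a,
          ← Real.rpow_natCast L, ← Real.rpow_natCast (a ^ (1 - t n)),
          ← Real.rpow_natCast (L ^ t n), ← Real.rpow_mul ha0.le, ← Real.rpow_mul hL.le,
          ← Real.rpow_mul ha0.le, ← Real.rpow_mul hL.le, mul_comm (k : ℝ), mul_comm (k : ℝ)]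
        ring

theorem norm_le_of_mem_spectrum_add {q y : B} {L : ℝ} (hL : 0 < L)
    (h : ∀ᶠ n : ℕ in atTop, ∀ᶠ k : ℕ in atTop, ∀ z : ℂ,
      ‖((n : ℂ) • q + z • y) ^ k‖ ≤ 3 * (24 * (‖z‖ + 1) * L) ^ k) {l : ℂ}
    (hl : l ∈ spectrum ℂ (q + y)) : ‖l‖ ≤ ‖y‖ := by
  have key : ∀ r : ℝ, 1 ≤ r → r * ‖l‖ ≤ r * ‖y‖ + ‖q‖ + 1 := by
    intro r hr
    have hr0 : (r : ℂ) ≠ 0 := by exact_mod_cast (by linarith : r ≠ 0)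
    have hmem : (r : ℂ) * l ∈ spectrum ℂ ((r : ℂ) • y + (r : ℂ) • q) := by
      rw [← smul_add, add_comm y]
      have := (spectrum.smul_mem_smul_iff (r := Units.mk0 (r : ℂ) hr0)).2 hl
      exact this
    have := norm_le_of_mem_spectrum_add_ofReal_smul (L := 24 * (r + 1) * L) (by positivity) ?_ hr hmem
    · rwa [norm_mul, norm_smul, Complex.norm_real, Real.norm_of_nonneg (by linarith)] at this
    · filter_upwards [h] with n hn
      filter_upwards [hn] with k hk z hz
      rw [smul_smul]
      refine (hk _).trans (le_of_eq ?_)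
      rw [norm_mul, hz, one_mul, Complex.norm_real, Real.norm_of_nonneg (by linarith)]
  by_contra! hlt
  have h1 := key (max 1 ((‖q‖ + 2) / (‖l‖ - ‖y‖))) (le_max_left _ _)
  have h2 := le_max_right 1 ((‖q‖ + 2) / (‖l‖ - ‖y‖))
  rw [div_le_iff₀ (by linarith)] at h2
  linarith

end Pencil

section Idempotent

variable {B : Type*} [NormedRing B] [NormedAlgebra ℂ B] [CompleteSpace B]

theorem catalan_le_four_pow (n : ℕ) : catalan n ≤ 4 ^ n := by
  rw [catalan_eq_centralBinom_div]
  refine (Nat.div_le_self _ _).trans ?_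
  rw [Nat.centralBinom, show (4 : ℕ) = 2 ^ 2 by norm_num, ← pow_mul]
  exact Nat.choose_le_two_pow _ _

/-- The generating function of the Catalan numbers at a quasinilpotent element. -/
theorem exists_catalan_series {b : B} (hb : ∀ l ∈ spectrum ℂ b, l = 0) :
    ∃ c : B, c = 1 + b * (c * c) ∧ ∀ x, Commute x b → Commute x c := by
  let F : ℕ → B := fun n => (catalan n : ℂ) • b ^ n
  have hsum : Summable fun n => ‖F n‖ := by
    have h1 : Summable fun n : ℕ => (1 / 2 : ℝ) ^ n :=
      summable_geometric_of_lt_one (by norm_num) (by norm_num)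
    refine h1.of_norm_bounded_eventually_nat ?_
    filter_upwards [eventually_norm_pow_le_of_spectrum (x := b) (M' := 1 / 8) le_rfl (by norm_num)
      (fun l hl => by simp [hb l hl])] with n hn
    rw [norm_norm, norm_smul, Complex.norm_natCast]
    calc (catalan n : ℝ) * ‖b ^ n‖ ≤ 4 ^ n * (1 / 8) ^ n := by
          gcongr
          exact_mod_cast catalan_le_four_pow n
      _ = (1 / 2) ^ n := by rw [← mul_pow]; norm_num
  have hprod : (∑' n, F n) * (∑' n, F n) = ∑' n, (catalan (n + 1) : ℂ) • b ^ n := by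
    rw [tsum_mul_tsum_eq_tsum_sum_antidiagonal_of_summable_norm hsum hsum]
    congr 1
    ext n
    rw [catalan_succ', Nat.cast_sum, Finset.sum_smul]
    refine Finset.sum_congr rfl fun ij hij => ?_
    rw [Finset.HasAntidiagonal.mem_antidiagonal] at hij
    rw [smul_mul_smul_comm, ← pow_add, hij, Nat.cast_mul]
  have hshift : Summable fun n => (catalan (n + 1) : ℂ) • b ^ n := by
    have := summable_sum_mul_antidiagonal_of_summable_mul
      (summable_mul_of_summable_norm hsum hsum)
    refine this.congr fun n => ?_
    rw [catalan_succ', Nat.cast_sum, Finset.sum_smul]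
    refine Finset.sum_congr rfl fun ij hij => ?_
    rw [Finset.HasAntidiagonal.mem_antidiagonal] at hij
    rw [smul_mul_smul_comm, ← pow_add, hij, Nat.cast_mul]
  refine ⟨∑' n, F n, ?_, fun x hx => Commute.tsum_right x fun n => (hx.pow_right n).smul_right _⟩
  rw [hprod, ← hshift.tsum_mul_left, hsum.of_norm.tsum_eq_zero_add]
  congr 1
  · simp [F]
  · congr 1
    ext n
    rw [mul_smul_comm, ← pow_succ']

theorem spectrum_mul_self_sub_eq_zero {f : B} (hf : ∀ l ∈ spectrum ℂ f, l = 0 ∨ l = 1) :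
    ∀ l ∈ spectrum ℂ (f * f - f), l = 0 := by
  intro l hl
  have h := spectrum.map_polynomial_aeval_of_nonempty (𝕜 := ℂ) f (X * X - X)
  rcases subsingleton_or_nontrivial B with hB | hB
  · simp [spectrum.of_subsingleton] at hl
  rw [map_sub, map_mul, aeval_X] at h
  rw [h (spectrum.nonempty f)] at hl
  obtain ⟨k, hk, rfl⟩ := hl
  rcases hf k hk with rfl | rfl <;> simp

/-- The Riesz idempotent of an element whose spectrum is contained in `{0, 1}`. -/
theorem exists_idempotent_of_spectrum {f : B} (hf : ∀ l ∈ spectrum ℂ f, l = 0 ∨ l = 1) :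
    ∃ p m : B, p * p = p ∧ Commute p f ∧ Commute (f * f - f) m ∧ Commute p m ∧
      f - p = (f * f - f) * m := by
  set a := f * f - f with ha
  have hqn := spectrum_mul_self_sub_eq_zero hf
  have hunit : IsUnit (1 + 4 * a) := by
    have h1 : (-1 / 4 : ℂ) ∉ spectrum ℂ a := fun h => by
      have := hqn _ h
      norm_num at this
    rw [spectrum.notMem_iff] at h1
    have h2 := h1.smul (Units.mk0 (-4 : ℂ) (by norm_num))
    convert h2 using 1
    have h3 : (4 : B) * a = (4 : ℂ) • a := by rw [Algebra.smul_def, map_ofNat]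
    rw [Units.smul_mk0, smul_sub, Algebra.algebraMap_eq_smul_one, smul_smul, h3, neg_smul,
      sub_neg_eq_add]
    norm_num
  obtain ⟨U, hU⟩ := hunit
  have hfa : Commute f a := ((Commute.refl f).mul_right (Commute.refl f)).sub_right (Commute.refl f)
  have hxU : ∀ x, Commute x a → Commute x (↑U⁻¹ : B) := fun x hx => by
    refine Commute.units_inv_right ?_
    rw [hU]
    exact (Commute.one_right x).add_right ((Commute.ofNat_right x 4).mul_right hx)
  set b := a * ↑U⁻¹ with hb
  have hbqn : ∀ l ∈ spectrum ℂ b, l = 0 :=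
    spectrum_mul_eq_zero_of_commute (hxU a (Commute.refl a)) hqn
  obtain ⟨c, hc, hcomm⟩ := exists_catalan_series hbqn
  have hxc : ∀ x, Commute x a → Commute x c := fun x hx => hcomm x (hx.mul_right (hxU x hx))
  set h := b * c with hh
  have hhh : h * h = h - b := by
    have hbc : c * b = b * c := ((hcomm b (Commute.refl b)).eq).symm
    have : b * c = b + b * (b * (c * c)) := by
      conv_lhs => rw [hc]
      rw [mul_add, mul_one]
    rw [hh, mul_assoc, ← mul_assoc c, hbc, mul_assoc b c c]
    conv_rhs => rw [this]
    rw [add_sub_cancel_left]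
  have hab : (1 - 2 * f) * ((1 - 2 * f) * b) = a := by
    have h1 : (1 - 2 * f) * ((1 - 2 * f) * b) = (1 + 4 * a) * b := by
      rw [ha]; noncomm_ring
    rw [h1, hb, (hxU a (Commute.refl a)).eq, ← mul_assoc, ← hU, Units.mul_inv, one_mul]
  have hfh : h * f = f * h :=
    ((hfa.mul_right (hxU f hfa)).mul_right (hxc f hfa)).symm.eq
  have hfU := hxU f hfa
  have hfc := hxc f hfa
  have hUc : Commute (↑U⁻¹ : B) c := hxc _ (hxU a (Commute.refl a)).symm
  have hdx : ∀ x, Commute x f → Commute x (1 - 2 * f) := fun x hx =>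
    (Commute.one_right x).sub_right ((Commute.ofNat_right x 2).mul_right hx)
  have hxm : ∀ x, Commute x f → Commute x (↑U⁻¹ : B) → Commute x c →
      Commute x (-((1 - 2 * f) * (↑U⁻¹ * c))) := fun x h1 h2 h3 =>
    ((hdx x h1).mul_right (h2.mul_right h3)).neg_right
  refine ⟨f + (1 - 2 * f) * h, -((1 - 2 * f) * (↑U⁻¹ * c)), ?_, ?_, ?_, ?_, ?_⟩
  · have h1 : (f + (1 - 2 * f) * h) * (f + (1 - 2 * f) * h) =
        f * f + 2 * (f * (1 - 2 * f)) * h + (1 - 2 * f) * ((1 - 2 * f) * (h * h)) := by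
      have h2 : ∀ x, h * (f * x) = f * (h * x) := fun x => by
        rw [← mul_assoc, hfh, mul_assoc]
      have h3 : (1 - 2 * f) * h * (f + (1 - 2 * f) * h) =
          (1 - 2 * f) * (f * h) + (1 - 2 * f) * ((1 - 2 * f) * (h * h)) := by
        have h4 : h * ((1 - 2 * f) * h) = (1 - 2 * f) * (h * h) := by
          have h5 : h * ((1 - 2 * f) * h) = h * h - 2 * (h * (f * h)) := by noncomm_ring
          rw [h5, h2]
          noncomm_ring
        rw [mul_add, mul_assoc, hfh, mul_assoc, h4]
      rw [add_mul, h3]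
      noncomm_ring
    have h2 : (1 - 2 * f) * ((1 - 2 * f) * (h * h)) = (1 - 2 * f) * ((1 - 2 * f) * h) - a := by
      rw [hhh, ← hab]
      noncomm_ring
    rw [h1, h2, ha]
    noncomm_ring
  · exact (Commute.refl f).add_left ((hdx f (Commute.refl f)).symm.mul_left hfh)
  · exact hxm a hfa.symm (hxU a (Commute.refl a)) (hxc a (Commute.refl a))
  · refine (hxm f (Commute.refl f) hfU hfc).add_left ((hxm _ ?_ ?_ ?_).mul_left (hxm _ ?_ ?_ ?_))
    · exact (hdx f (Commute.refl f)).symm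
    · exact (hdx _ hfU.symm).symm
    · exact (hdx _ hfc.symm).symm
    · exact hfh
    · exact ((hxU a (Commute.refl a)).mul_left (Commute.refl _)).mul_left hUc.symm
    · exact ((hxc a (Commute.refl a)).mul_left hUc).mul_left (Commute.refl c)
  · rw [mul_neg, ← mul_assoc a, (hdx a hfa.symm).eq, hh, hb]
    noncomm_ring

end Idempotent
section Corner

variable {B : Type*} [NormedRing B] [NormedAlgebra ℂ B] [CompleteSpace B]

omit [CompleteSpace B] in
theorem isUnit_one_sub_smul_iff {x : B} {w : ℂ} (hw : w ≠ 0) :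
    IsUnit (1 - w • x) ↔ w⁻¹ ∉ spectrum ℂ x := by
  rw [spectrum.notMem_iff, ← isUnit_smul_iff (Units.mk0 w hw) (algebraMap ℂ B w⁻¹ - x),
    Units.smul_mk0, smul_sub, Algebra.algebraMap_eq_smul_one, smul_smul, mul_inv_cancel₀ hw,
    one_smul]

omit [CompleteSpace B] in
theorem spectrum_eq_zero_of_isUnit_one_sub_smul {x : B} (h : ∀ w : ℂ, IsUnit (1 - w • x)) :
    ∀ l ∈ spectrum ℂ x, l = 0 := by
  intro l hl
  by_contra hl0
  exact (isUnit_one_sub_smul_iff (inv_ne_zero hl0)).1 (h l⁻¹) (by rwa [inv_inv])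

omit [CompleteSpace B] in
theorem isUnit_one_sub_smul_of_spectrum {x : B} (h : ∀ l ∈ spectrum ℂ x, l = 0) (w : ℂ) :
    IsUnit (1 - w • x) := by
  rcases eq_or_ne w 0 with rfl | hw
  · simp
  · exact (isUnit_one_sub_smul_iff hw).2 fun hl => inv_ne_zero hw (h _ hl)

/-- If every perturbation of `q` by a corner element `y` has spectral radius at most `‖y‖`, then
the left ideal generated by `q` consists of quasinilpotent elements. -/
theorem spectrum_mul_eq_zero_of_norm_le {p q : B} (hpp : p * p = p) (hpq : p * q = q)
    (hqp : q * p = q)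
    (h : ∀ y, p * y = y → y * p = y → ∀ l ∈ spectrum ℂ (q + y), ‖l‖ ≤ ‖y‖) (c : B) :
    ∀ l ∈ spectrum ℂ (c * q), l = 0 := by
  have hunit : ∀ y, p * y = y → y * p = y → ‖y‖ < 1 → ∀ w : ℂ, IsUnit (1 - y - w • q) := by
    intro y h1 h2 hy w
    rcases eq_or_ne w 0 with rfl | hw
    · simpa using isUnit_one_sub_of_norm_lt_one hy
    · have h3 : (1 : B) - y - w • q = 1 - w • (q + w⁻¹ • y) := by
        rw [smul_add, smul_smul, mul_inv_cancel₀ hw, one_smul]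
        abel
      rw [h3, isUnit_one_sub_smul_iff hw]
      intro hl
      have h4 := h (w⁻¹ • y) (by rw [mul_smul_comm, h1]) (by rw [smul_mul_assoc, h2]) _ hl
      rw [norm_smul] at h4
      have : 0 < ‖w⁻¹‖ := norm_pos_iff.2 (inv_ne_zero hw)
      nlinarith
  have hsmall : ∀ c, p * c = c → c * p = c → ∀ᶠ s : ℝ in 𝓝 0,
      ∀ l ∈ spectrum ℂ ((1 + (s : ℂ) • c) * q), l = 0 := by
    intro c h1 h2
    have hcont : Tendsto (fun s : ℝ => 1 + (s : ℂ) • c) (𝓝 0) (𝓝 1) := by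
      have : Continuous fun s : ℝ => 1 + (s : ℂ) • c := by fun_prop
      simpa using this.tendsto 0
    have hinv : Tendsto (fun s : ℝ => Ring.inverse (1 + (s : ℂ) • c)) (𝓝 0) (𝓝 1) := by
      have h3 := (NormedRing.inverse_continuousAt (1 : Bˣ)).tendsto
      simp only [Units.val_one, Ring.inverse_one] at h3
      exact h3.comp hcont
    have hsub : ∀ᶠ s : ℝ in 𝓝 0, ‖1 - Ring.inverse (1 + (s : ℂ) • c)‖ < 1 := by
      have h3 := ((tendsto_const_nhds (x := (1 : B))).sub hinv).norm
      rw [sub_self, norm_zero] at h3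
      exact h3.eventually_lt_const one_pos
    have hu : ∀ᶠ s : ℝ in 𝓝 0, IsUnit (1 + (s : ℂ) • c) :=
      hcont.eventually (Units.isOpen.mem_nhds isUnit_one)
    filter_upwards [hsub, hu] with s hs hsu
    set r := Ring.inverse (1 + (s : ℂ) • c) with hr
    have hr1 : r * (1 + (s : ℂ) • c) = 1 := Ring.inverse_mul_cancel _ hsu
    have hr2 : (1 + (s : ℂ) • c) * r = 1 := Ring.mul_inverse_cancel _ hsu
    have hy1 : 1 - r = (s : ℂ) • c * r := by
      rw [add_mul, one_mul] at hr2
      rw [← hr2]; abel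
    have hy2 : 1 - r = r * (s : ℂ) • c := by
      rw [mul_add, mul_one] at hr1
      rw [← hr1]; abel
    refine spectrum_eq_zero_of_isUnit_one_sub_smul fun w => ?_
    have h3 := hunit (1 - r) (by rw [hy1, ← mul_assoc, mul_smul_comm, h1])
      (by rw [hy2, mul_assoc, smul_mul_assoc, h2]) hs w
    rw [sub_sub_cancel] at h3
    have h4 := hsu.mul h3
    rwa [mul_sub, hr2, mul_smul_comm] at h4
  have hcorner : ∀ c, p * c = c → c * p = c → ∀ l ∈ spectrum ℂ (c * q), l = 0 := by
    intro c h1 h2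
    obtain ⟨d, hd, hds⟩ := Metric.eventually_nhds_iff.1 (hsmall c h1 h2)
    have hbig : ∀ t : ℝ, 2 / d ≤ t → ∀ l ∈ spectrum ℂ (c * q + (t : ℂ) • q), l = 0 := by
      intro t ht
      have ht0 : 0 < t := (by positivity : 0 < 2 / d).trans_le ht
      have h3 := hds (y := t⁻¹) (by
        rw [Real.dist_eq, sub_zero, abs_of_pos (inv_pos.2 ht0), inv_lt_comm₀ ht0 hd]
        refine lt_of_lt_of_le ?_ ht
        rw [inv_eq_one_div]
        gcongr
        norm_num)
      have h5 : c * q + (t : ℂ) • q = (t : ℂ) • ((1 + ((t⁻¹ : ℝ) : ℂ) • c) * q) := by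
        have h6 : (t : ℂ) * ((t⁻¹ : ℝ) : ℂ) = 1 := by
          push_cast
          exact mul_inv_cancel₀ (by exact_mod_cast ht0.ne')
        rw [add_mul, one_mul, smul_add, smul_mul_assoc, smul_smul, h6, one_smul, add_comm]
      rw [h5]
      refine spectrum_eq_zero_of_isUnit_one_sub_smul fun w => ?_
      rw [smul_smul]
      exact isUnit_one_sub_smul_of_spectrum h3 _
    have hev : ∀ ε : ℝ, 0 < ε → ∀ l ∈ spectrum ℂ (c * q),
        ‖l‖ ≤ 24 * (‖-((2 / d : ℝ) : ℂ)‖ + 1) * ε := by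
      intro ε hε l hl
      refine norm_le_of_mem_spectrum_of_frequently (C := 3) (by positivity)
        (Eventually.frequently ?_) hl
      have hvol : ENNReal.ofReal (1 / 2) < MeasureTheory.volume (Set.Icc (0 : ℝ) 1) := by
        rw [Real.volume_Icc]
        exact (ENNReal.ofReal_lt_ofReal_iff (by norm_num)).2 (by norm_num)
      filter_upwards [eventually_norm_add_smul_pow_le (x := c * q + ((2 / d : ℝ) : ℂ) • q) (y := q)
        subset_rfl hvol le_rfl hε fun t ht l hl => by
          rw [add_assoc, ← add_smul, ← Complex.ofReal_add] at hl
          rw [hbig _ (by linarith [ht.1]) l hl, norm_zero]] with k hk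
      simpa using hk (-((2 / d : ℝ) : ℂ))
    intro l hl
    rw [← norm_le_zero_iff]
    have hlim : Tendsto (fun ε : ℝ => 24 * (‖-((2 / d : ℝ) : ℂ)‖ + 1) * ε) (𝓝[>] 0) (𝓝 0) := by
      have : Continuous fun ε : ℝ => 24 * (‖-((2 / d : ℝ) : ℂ)‖ + 1) * ε := by fun_prop
      simpa using (this.tendsto 0).mono_left nhdsWithin_le_nhds
    exact ge_of_tendsto hlim (eventually_mem_nhdsWithin.mono fun ε hε => hev ε hε l hl)
  intro l hl
  by_contra hl0
  have h1 : l ∈ spectrum ℂ (p * (c * q)) \ {0} := by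
    rw [spectrum.nonzero_mul_comm, mul_assoc, hqp]
    exact ⟨hl, hl0⟩
  refine hl0 (hcorner (p * c * p) ?_ ?_ l ?_)
  · rw [← mul_assoc, ← mul_assoc, hpp]
  · rw [mul_assoc, hpp]
  · rw [mul_assoc _ p q, hpq, mul_assoc]
    exact h1.1

end Corner
section Perturbation

variable {B : Type*} [NormedRing B] [NormedAlgebra ℂ B]

theorem mem_spectrum_add_of_mul_eq_zero {u v : B} (huv : u * v = 0) (hvu : v * u = 0) {l : ℂ}
    (hl : l ∈ spectrum ℂ v) (hl0 : l ≠ 0) : l ∈ spectrum ℂ (u + v) := by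
  contrapose! hl
  rw [spectrum.notMem_iff] at hl ⊢
  have h1 : (algebraMap ℂ B l - u) * (algebraMap ℂ B l - v) =
      Units.mk0 l hl0 • (algebraMap ℂ B l - (u + v)) := by
    rw [Units.smul_mk0, Algebra.algebraMap_eq_smul_one, mul_sub, sub_mul, sub_mul, huv]
    simp only [smul_sub, smul_add, smul_mul_assoc, mul_smul_comm, one_mul, mul_one]
    abel
  have h2 : Commute (algebraMap ℂ B l - u) (algebraMap ℂ B l - v) := by
    refine ((Algebra.commute_algebraMap_left l _).sub_right
      (Algebra.commute_algebraMap_left l v)).sub_left ?_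
    exact (Algebra.commute_algebraMap_right l u).sub_right (huv.trans hvu.symm)
  have h3 := hl.smul (Units.mk0 l hl0)
  rw [← h1, h2.isUnit_mul_iff] at h3
  exact h3.2

variable [CompleteSpace B]

theorem eventually_norm_le_half_of_mem_spectrum {q y : B} (hq : ∀ l ∈ spectrum ℂ q, l = 0) :
    ∀ᶠ n : ℕ in atTop, ∀ t ∈ Set.Icc (0 : ℝ) 1,
      ∀ l ∈ spectrum ℂ ((n : ℂ) • q + (t : ℂ) • y), ‖l‖ < n / 2 := by
  have hk : ∀ᶠ k : ℕ in atTop, ‖q ^ k‖ * ‖(1 : B)‖ < (1 / 2) ^ k := by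
    filter_upwards [eventually_norm_pow_le_of_spectrum (x := q) (M' := 1 / 4) le_rfl (by norm_num)
      (fun l hl => by simp [hq l hl]),
      (tendsto_pow_atTop_atTop_of_one_lt (one_lt_two (α := ℝ))).eventually_gt_atTop ‖(1 : B)‖]
      with k h1 h2
    calc ‖q ^ k‖ * ‖(1 : B)‖ ≤ (1 / 4) ^ k * ‖(1 : B)‖ := by gcongr
      _ < (1 / 4) ^ k * 2 ^ k := by gcongr
      _ = (1 / 2) ^ k := by rw [← mul_pow]; norm_num
  obtain ⟨k, hk⟩ := hk.exists
  have hcont : Continuous fun s : ℝ => ‖(q + (s : ℂ) • y) ^ k‖ * ‖(1 : B)‖ := by fun_prop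
  have hev : ∀ᶠ s : ℝ in 𝓝 0, ‖(q + (s : ℂ) • y) ^ k‖ * ‖(1 : B)‖ < (1 / 2) ^ k :=
    (hcont.tendsto 0).eventually_lt_const (by simpa using hk)
  obtain ⟨d, hd, hds⟩ := Metric.eventually_nhds_iff.1 hev
  filter_upwards [tendsto_natCast_atTop_atTop.eventually_gt_atTop (1 / d)] with n hn t ht l hl
  have hn0 : (0 : ℝ) < n := (by positivity : 0 < 1 / d).trans hn
  have hnC : (n : ℂ) ≠ 0 := by exact_mod_cast hn0.ne'
  have h1 := hds (y := t / n) (by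
    rw [Real.dist_eq, sub_zero, abs_of_nonneg (div_nonneg ht.1 hn0.le), div_lt_iff₀ hn0]
    rw [div_lt_iff₀ hd] at hn
    linarith [ht.2])
  have h2 : (n : ℂ) • q + (t : ℂ) • y = (n : ℂ) • (q + ((t / n : ℝ) : ℂ) • y) := by
    rw [smul_add, smul_smul]
    congr 2
    push_cast
    field_simp
  have h3 : (n : ℂ)⁻¹ * l ∈ spectrum ℂ (q + ((t / n : ℝ) : ℂ) • y) := by
    rw [h2] at hl
    have := (spectrum.smul_mem_smul_iff (r := (Units.mk0 (n : ℂ) hnC)⁻¹)).2 hl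
    simpa [Units.smul_def, smul_smul, hnC] using this
  have h4 := lt_of_pow_lt_pow_left₀ k (by norm_num)
    ((norm_pow_le_of_mem_spectrum h3 k).trans_lt h1)
  rw [norm_mul, norm_inv, Complex.norm_natCast, inv_mul_lt_iff₀ hn0] at h4
  linarith

theorem spectrum_mul_eq_zero_of_perturbation {f e : B} {g : B → ℝ}
    (H : ∀ (n : ℕ) (y : B), ∀ l ∈ spectrum ℂ ((n : ℂ) • f + y), ‖l‖ ≤ g y ∨ ‖l - n‖ ≤ g y)
    (he : e * e = e) (hef : Commute e f) (hq : ∀ l ∈ spectrum ℂ (e * f), l = 0) (c : B) :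
    ∀ l ∈ spectrum ℂ (c * (e * f)), l = 0 := by
  refine spectrum_mul_eq_zero_of_norm_le he (by rw [← mul_assoc, he])
    (by rw [hef.eq, mul_assoc, he]) (fun y hy1 hy2 l hl => ?_) c
  let S : ℕ → Set ℝ := fun M => {t | t ∈ Set.Icc (0 : ℝ) 1 ∧ g ((t : ℂ) • y) ≤ M}
  have hS : Monotone S := fun M N hMN t ht => ⟨ht.1, ht.2.trans (by exact_mod_cast hMN)⟩
  have hU : ⋃ M, S M = Set.Icc (0 : ℝ) 1 := by
    ext t
    simp only [Set.mem_iUnion]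
    exact ⟨fun ⟨M, hM⟩ => hM.1, fun ht => ⟨⌈g ((t : ℂ) • y)⌉₊, ht, Nat.le_ceil _⟩⟩
  have hvol : ENNReal.ofReal (1 / 2) < MeasureTheory.volume (⋃ M, S M) := by
    rw [hU, Real.volume_Icc]
    exact (ENNReal.ofReal_lt_ofReal_iff (by norm_num)).2 (by norm_num)
  obtain ⟨M, hM⟩ :=
    ((MeasureTheory.tendsto_measure_iUnion_atTop hS).eventually_const_lt hvol).exists
  have hM0 : (0 : ℝ) ≤ M := M.cast_nonneg
  refine norm_le_of_mem_spectrum_add (L := (M : ℝ) + 1) (by positivity) ?_ hl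
  filter_upwards [eventually_norm_le_half_of_mem_spectrum (y := y) hq,
    eventually_ge_atTop (2 * M)] with n hn hnM
  refine eventually_norm_add_smul_pow_le (S := S M) (fun t ht => ht.1) hM hM0 (by linarith)
    fun t ht l hl => ?_
  rcases eq_or_ne l 0 with rfl | hl0
  · simp [hM0]
  have hye : (1 - e) * f * y = 0 := by
    rw [sub_mul, one_mul, hef.eq, sub_mul, mul_assoc, hy1, sub_self]
  have hfe : (1 - e) * f * (e * f) = 0 := by
    have h2 : e * (f * e) = f * e := by rw [← mul_assoc, hef.eq, mul_assoc, he]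
    rw [sub_mul, one_mul, hef.eq, sub_mul, mul_assoc f e, h2, sub_self]
  have hye' : y * ((1 - e) * f) = 0 := by
    rw [← mul_assoc, mul_sub, mul_one, hy2, sub_self, zero_mul]
  have hfe' : e * f * ((1 - e) * f) = 0 := by
    rw [hef.eq, mul_assoc, ← mul_assoc e, mul_sub, mul_one, he, sub_self, zero_mul, mul_zero]
  have h1 := mem_spectrum_add_of_mul_eq_zero (u := (n : ℂ) • ((1 - e) * f))
    (v := (n : ℂ) • (e * f) + (t : ℂ) • y)
    (by simp only [mul_add, mul_smul_comm, smul_mul_assoc, hye, hfe, smul_zero, add_zero])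
    (by simp only [add_mul, mul_smul_comm, smul_mul_assoc, hye', hfe', smul_zero, add_zero]) hl hl0
  rw [← add_assoc, ← smul_add, ← add_mul, sub_add_cancel, one_mul] at h1
  rcases H n _ l h1 with h2 | h2
  · exact h2.trans ht.2
  · have h3 := hn t ht.1 l hl
    have h4 : (n : ℝ) ≤ ‖l‖ + ‖l - n‖ := by
      have := norm_sub_le l (l - n)
      rwa [sub_sub_cancel, Complex.norm_natCast] at this
    have h5 : (2 : ℝ) * M ≤ n := by exact_mod_cast hnM
    linarith [h2.trans ht.2]

end Perturbation
section Semisimple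

variable {A : Type*} [NormedRing A] [NormedAlgebra ℂ A] [CompleteSpace A]

/-- An element whose translates of units are units belongs to the Jacobson radical. -/
theorem isUnit_one_add_mul_of_forall_isUnit_add {x : A} (h : ∀ u, IsUnit u → IsUnit (u + x))
    (c : A) : IsUnit (1 + c * x) := by
  have hmul : ∀ v, IsUnit v → ∀ u, IsUnit u → IsUnit (u + v * x) := by
    rintro _ ⟨v, rfl⟩ u hu
    have h1 := v.isUnit.mul (h _ ((v⁻¹).isUnit.mul hu))
    rwa [mul_add, Units.mul_inv_cancel_left] at h1
  obtain ⟨r, hr⟩ := exists_gt (‖c‖ * ‖(1 : A)‖)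
  have hr0 : 0 < r := (by positivity : 0 ≤ ‖c‖ * ‖(1 : A)‖).trans_lt hr
  have h1 : (r : ℂ) ∉ spectrum ℂ c := fun hl => by
    have := spectrum.norm_le_norm_mul_of_mem hl
    rw [Complex.norm_real, Real.norm_of_nonneg hr0.le] at this
    linarith
  rw [spectrum.notMem_iff, ← IsUnit.neg_iff, neg_sub] at h1
  have h2 : IsUnit (algebraMap ℂ A r) :=
    (IsUnit.mk0 (r : ℂ) (by exact_mod_cast hr0.ne')).map _
  have h3 := hmul _ h1 _ (hmul _ h2 1 isUnit_one)
  rwa [add_assoc, ← add_mul, add_sub_cancel] at h3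

omit [NormedAlgebra ℂ A] [CompleteSpace A] in
theorem eq_zero_of_forall_isUnit_one_add_mul (hA : Ideal.jacobson (⊥ : Ideal A) = ⊥) {x : A}
    (h : ∀ c, IsUnit (1 + c * x)) : x = 0 := by
  have hx : x ∈ Ideal.jacobson (⊥ : Ideal A) := by
    refine Ideal.mem_jacobson_iff.2 fun c => ?_
    obtain ⟨u, hu⟩ := h c
    refine ⟨(↑u⁻¹ : A), ?_⟩
    have h1 : (↑u⁻¹ : A) * (1 + c * x) = 1 := by rw [← hu, Units.inv_mul]
    rw [mul_add, mul_one] at h1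
    rw [Ideal.mem_bot, mul_assoc, add_comm, h1, sub_self]
  rwa [hA, Ideal.mem_bot] at hx

theorem norm_le_or_norm_sub_le_of_mem_spectrum_idempotent {e x : A} (he : e * e = e) (n : ℕ)
    {l : ℂ} (hl : l ∈ spectrum ℂ ((n : ℂ) • e + x)) :
    ‖l‖ ≤ (‖e‖ + ‖1 - e‖ + 1) * ‖x‖ ∨ ‖l - n‖ ≤ (‖e‖ + ‖1 - e‖ + 1) * ‖x‖ := by
  by_contra! hcon
  set C := ‖e‖ + ‖1 - e‖ + 1 with hC
  have hC0 : 0 < C := by positivity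
  have hpos : 0 ≤ C * ‖x‖ := by positivity
  have hinv : ∀ w : ℂ, C * ‖x‖ < ‖w‖ → w ≠ 0 ∧ ‖w⁻¹‖ * ‖x‖ ≤ C⁻¹ := by
    intro w hw
    have hw0 : 0 < ‖w‖ := hpos.trans_lt hw
    refine ⟨norm_pos_iff.1 hw0, ?_⟩
    rw [norm_inv, inv_mul_le_iff₀ hw0, ← div_eq_mul_inv, le_div_iff₀ hC0]
    linarith
  obtain ⟨hl0, h1⟩ := hinv l hcon.1
  obtain ⟨hn0, h2⟩ := hinv _ hcon.2
  set R : A := l⁻¹ • (1 - e) + (l - n)⁻¹ • e with hR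
  set D : A := algebraMap ℂ A l - (n : ℂ) • e with hD
  have hD' : D = l • (1 - e) + (l - n) • e := by
    rw [hD, Algebra.algebraMap_eq_smul_one, smul_sub, sub_smul]
    abel
  have he1 : e * (1 - e) = 0 := by rw [mul_sub, mul_one, he, sub_self]
  have he2 : (1 - e) * e = 0 := by rw [sub_mul, one_mul, he, sub_self]
  have he3 : (1 - e) * (1 - e) = 1 - e := by rw [mul_sub, he2, mul_one, sub_zero]
  have hDR : D * R = 1 := by
    rw [hD', hR]
    simp only [mul_add, add_mul, smul_mul_smul_comm, he, he1, he2, he3, mul_inv_cancel₀ hl0,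
      mul_inv_cancel₀ hn0, smul_zero, one_smul, add_zero, zero_add, sub_add_cancel]
  have hRD : R * D = 1 := by
    rw [hD', hR]
    simp only [mul_add, add_mul, smul_mul_smul_comm, he, he1, he2, he3, inv_mul_cancel₀ hl0,
      inv_mul_cancel₀ hn0, smul_zero, one_smul, add_zero, zero_add, sub_add_cancel]
  have hRx : ‖R * x‖ < 1 := by
    calc ‖R * x‖ ≤ (‖l⁻¹‖ * ‖1 - e‖ + ‖(l - n)⁻¹‖ * ‖e‖) * ‖x‖ := by
          refine (norm_mul_le _ _).trans ?_
          gcongr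
          exact (norm_add_le _ _).trans_eq (by rw [norm_smul, norm_smul])
      _ = (‖l⁻¹‖ * ‖x‖) * ‖1 - e‖ + (‖(l - n)⁻¹‖ * ‖x‖) * ‖e‖ := by ring
      _ ≤ C⁻¹ * ‖1 - e‖ + C⁻¹ * ‖e‖ := by gcongr
      _ = (‖e‖ + ‖1 - e‖) / C := by ring
      _ < 1 := by rw [div_lt_one hC0, hC]; linarith
  have hunit : IsUnit (D * (1 - R * x)) :=
    (show IsUnit D from ⟨⟨D, R, hDR, hRD⟩, rfl⟩).mul (isUnit_one_sub_of_norm_lt_one hRx)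
  rw [mul_sub, ← mul_assoc, hDR, one_mul, mul_one, hD, sub_sub] at hunit
  exact hl hunit

end Semisimple

section Preserver

variable {A B : Type*} [NormedRing A] [NormedAlgebra ℂ A] [CompleteSpace A]
  [NormedRing B] [NormedAlgebra ℂ B] [CompleteSpace B]

omit [CompleteSpace A] [CompleteSpace B] in
theorem isUnit_map_iff_of_spectrum_eq {T : A → B}
    (hspec : ∀ x : A, spectrum ℂ (T x) = spectrum ℂ x) (x : A) : IsUnit (T x) ↔ IsUnit x := by
  rw [← spectrum.zero_notMem_iff ℂ, hspec, spectrum.zero_notMem_iff]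

omit [CompleteSpace B] in
/-- The range of an additive spectrum preserving map on a semisimple algebra is semisimple. -/
theorem eq_zero_of_surjective_of_spectrum_eq (hA : Ideal.jacobson (⊥ : Ideal A) = ⊥)
    {T : A → B} (hsurj : Function.Surjective T) (hadd : ∀ x y : A, T (x + y) = T x + T y)
    (hspec : ∀ x : A, spectrum ℂ (T x) = spectrum ℂ x) {b : B}
    (hb : ∀ c, IsUnit (1 + c * b)) : b = 0 := by
  obtain ⟨x, rfl⟩ := hsurj b
  have hx : x = 0 := by
    refine eq_zero_of_forall_isUnit_one_add_mul hA
      (isUnit_one_add_mul_of_forall_isUnit_add fun u hu => ?_)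
    rw [← isUnit_map_iff_of_spectrum_eq hspec, hadd]
    obtain ⟨v, hv⟩ := (isUnit_map_iff_of_spectrum_eq hspec u).2 hu
    have h1 := v.isUnit.mul (hb (↑v⁻¹ : B))
    rwa [mul_add, mul_one, Units.mul_inv_cancel_left, hv] at h1
  have h0 := hadd 0 0
  rw [hx]
  simpa using h0

theorem map_one_of_surjective_of_spectrum_eq (hA : Ideal.jacobson (⊥ : Ideal A) = ⊥)
    {T : A → B} (hsurj : Function.Surjective T) (hadd : ∀ x y : A, T (x + y) = T x + T y)
    (hspec : ∀ x : A, spectrum ℂ (T x) = spectrum ℂ x) : T 1 = 1 := by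
  rw [← sub_eq_zero]
  refine eq_zero_of_surjective_of_spectrum_eq hA hsurj hadd hspec
    (isUnit_one_add_mul_of_forall_isUnit_add fun u hu => ?_)
  obtain ⟨x, rfl⟩ := hsurj u
  have h1 : (1 : ℂ) ∉ spectrum ℂ (T (x + 1)) := by
    rw [hspec, spectrum.notMem_iff, map_one, ← IsUnit.neg_iff, neg_sub, add_sub_cancel_right]
    exact (isUnit_map_iff_of_spectrum_eq hspec x).1 hu
  rw [spectrum.notMem_iff, map_one, ← IsUnit.neg_iff, neg_sub, hadd] at h1
  rwa [← add_sub_assoc]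

/-- For an additive spectrum preserving surjection `T`, the Riesz idempotent of the image of an
idempotent absorbs that image. -/
theorem mul_map_eq_zero_of_commute (hA : Ideal.jacobson (⊥ : Ideal A) = ⊥)
    {T : A → B} (hsurj : Function.Surjective T) (hadd : ∀ x y : A, T (x + y) = T x + T y)
    (hspec : ∀ x : A, spectrum ℂ (T x) = spectrum ℂ x) {e : A} (he : e * e = e) {r : B}
    (hr : r * r = r) (hre : Commute r (T e)) (hq : ∀ l ∈ spectrum ℂ (r * T e), l = 0) :
    r * T e = 0 := by
  refine eq_zero_of_surjective_of_spectrum_eq hA hsurj hadd hspec fun c => ?_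
  have hsmul : ∀ n : ℕ, T ((n : ℂ) • e) = (n : ℂ) • T e := by
    have h : ∀ n : ℕ, T (n • e) = n • T e := fun n =>
      map_nsmul (AddMonoidHom.mk' T hadd) n e
    intro n
    rw [Nat.cast_smul_eq_nsmul, Nat.cast_smul_eq_nsmul, h]
  obtain ⟨S, hS⟩ := hsurj.hasRightInverse
  have h1 := spectrum_mul_eq_zero_of_perturbation
    (g := fun y => (‖e‖ + ‖1 - e‖ + 1) * ‖S y‖) (fun n y l hl => by
      rw [← hS y, ← hsmul, ← hadd, hspec] at hl
      simpa only [hS y] using norm_le_or_norm_sub_le_of_mem_spectrum_idempotent he n hl)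
    hr hre hq c
  simpa using isUnit_one_sub_smul_of_spectrum h1 (-1)

end Preserver

/-- A surjective additive spectrum preserving map from a semisimple complex unital
Banach algebra maps idempotents to idempotents. -/
theorem additive_spectrum_preserving_maps_idempotents
    {A B : Type*} [NormedRing A] [NormedAlgebra ℂ A] [CompleteSpace A]
    [NormedRing B] [NormedAlgebra ℂ B] [CompleteSpace B]
    (hA : Ideal.jacobson (⊥ : Ideal A) = ⊥)
    (T : A → B)
    (hsurj : Function.Surjective T)
    (hadd : ∀ x y : A, T (x + y) = T x + T y)
    (hspec : ∀ x : A, spectrum ℂ (T x) = spectrum ℂ x) :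
    ∀ e : A, e * e = e → T e * T e = T e := by
  intro e he
  have hf : ∀ l ∈ spectrum ℂ (T e), l = 0 ∨ l = 1 := fun l hl => by
    rw [hspec] at hl
    simpa [sub_eq_zero] using norm_le_or_norm_sub_le_of_mem_spectrum_idempotent he 1
      (x := 0) (l := l) (by simpa using hl)
  obtain ⟨p, m, hpp, hpf, ham, hpm, hfp⟩ := exists_idempotent_of_spectrum hf
  have ha := spectrum_mul_self_sub_eq_zero hf
  have hpa : Commute p (T e * T e - T e) := (hpf.mul_right hpf).sub_right hpf
  have hp1 : (1 - p) * (1 - p) = 1 - p := by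
    rw [mul_sub, sub_mul, sub_mul, one_mul, mul_one, one_mul, hpp, sub_self, sub_zero]
  have hT1e : T (1 - e) = 1 - T e := by
    rw [eq_sub_iff_add_eq, ← hadd, sub_add_cancel]
    exact map_one_of_surjective_of_spectrum_eq hA hsurj hadd hspec
  have he1 : (1 - e) * (1 - e) = 1 - e := by
    rw [mul_sub, sub_mul, sub_mul, one_mul, mul_one, one_mul, he, sub_self, sub_zero]
  have h1 : (1 - p) * T e = 0 := by
    refine mul_map_eq_zero_of_commute hA hsurj hadd hspec he hp1
      ((Commute.one_left _).sub_left hpf) ?_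
    have h2 : (1 - p) * T e = (T e * T e - T e) * ((1 - p) * m) := by
      rw [← mul_assoc, ← ((Commute.one_left _).sub_left hpa).eq, mul_assoc, ← hfp, mul_sub,
        sub_mul 1 p p, one_mul, hpp, sub_self, sub_zero]
    rw [h2]
    exact spectrum_mul_eq_zero_of_commute
      (((Commute.one_right _).sub_right hpa.symm).mul_right ham) ha
  have h2 : p * T (1 - e) = 0 := by
    refine mul_map_eq_zero_of_commute hA hsurj hadd hspec he1 hpp
      (hT1e ▸ (Commute.one_right _).sub_right hpf) ?_
    have h3 : p * T (1 - e) = (T e * T e - T e) * (-(p * m)) := by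
      rw [mul_neg, ← mul_assoc, ← hpa.eq, mul_assoc, ← hfp, hT1e, mul_sub, mul_sub, hpp, mul_one,
        neg_sub]
    rw [h3]
    exact spectrum_mul_eq_zero_of_commute ((hpa.symm.mul_right ham).neg_right) ha
  rw [hT1e, mul_sub, mul_one, sub_eq_zero] at h2
  rw [sub_mul, one_mul, sub_eq_zero, ← h2] at h1
  rw [h1, hpp]
end
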